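/- arXiv:1206.2066 — 2 statements merged into one kernel-verified Lean document; each statement's English description precedes it below -/
import Mathlib

section
/- Let X be a (G,H)-equivalence of second countable locally compact Hausdorff groupoids with Haar systems, E = G⋉X⋊H the iterated transformation groupoid with its natural Haar system, and μ a Radon measure on X quasi-invariant with respect to E. Then μ is quasi-invariant with respect to the transformation groupoid Ḡ = G⋉X (and by symmetry with respect to H̄ = X⋊H). -/
open MeasureTheory Filter Topology

/-- Algebraic data of a groupoid: arrows, objects (units), range, source,
unit inclusion, (total extensions of) composition and inversion. -/
structure GroupoidData (Arr : Type) (Obj : Type) where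
  r : Arr → Obj
  s : Arr → Obj
  unit : Obj → Arr
  comp : Arr → Arr → Arr
  inv : Arr → Arr

/-- The axioms making `GroupoidData` an honest groupoid (composition is only
required to behave on composable pairs). -/
structure GroupoidData.IsGroupoid {Arr Obj : Type} (D : GroupoidData Arr Obj) : Prop where
  r_unit : ∀ u, D.r (D.unit u) = u
  s_unit : ∀ u, D.s (D.unit u) = u
  r_comp : ∀ a b, D.s a = D.r b → D.r (D.comp a b) = D.r a
  s_comp : ∀ a b, D.s a = D.r b → D.s (D.comp a b) = D.s b
  comp_assoc : ∀ a b c, D.s a = D.r b → D.s b = D.r c →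
    D.comp (D.comp a b) c = D.comp a (D.comp b c)
  unit_comp : ∀ a, D.comp (D.unit (D.r a)) a = a
  comp_unit : ∀ a, D.comp a (D.unit (D.s a)) = a
  r_inv : ∀ a, D.r (D.inv a) = D.s a
  s_inv : ∀ a, D.s (D.inv a) = D.r a
  inv_comp : ∀ a, D.comp (D.inv a) a = D.unit (D.s a)
  comp_inv : ∀ a, D.comp a (D.inv a) = D.unit (D.r a)

/-- A left action of the groupoid `G` on a set `X` with moment map `rX`;
`lact γ x` is only meaningful when `G.s γ = rX x`. -/
structure IsLeftActionOf {ArrG ObjG X : Type} (G : GroupoidData ArrG ObjG)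
    (rX : X → ObjG) (lact : ArrG → X → X) : Prop where
  moment : ∀ γ x, G.s γ = rX x → rX (lact γ x) = G.r γ
  unit_act : ∀ x, lact (G.unit (rX x)) x = x
  comp_act : ∀ γ ξ x, G.s γ = G.r ξ → G.s ξ = rX x →
    lact (G.comp γ ξ) x = lact γ (lact ξ x)

/-- A right action of the groupoid `H` on a set `X` with moment map `sX`;
`ract x η` is only meaningful when `sX x = H.r η`. -/
structure IsRightActionOf {ArrH ObjH X : Type} (H : GroupoidData ArrH ObjH)
    (sX : X → ObjH) (ract : X → ArrH → X) : Prop where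
  moment : ∀ x η, sX x = H.r η → sX (ract x η) = H.s η
  unit_act : ∀ x, ract x (H.unit (sX x)) = x
  comp_act : ∀ x η ζ, sX x = H.r η → H.s η = H.r ζ →
    ract x (H.comp η ζ) = ract (ract x η) ζ

/-- The algebraic part of `X` being a `(G,H)`-equivalence: commuting free
left `G`- and right `H`-actions, each moment map invariant under the other
action, whose fibres are exactly the orbits of the other action, and both
moment maps surjective. -/
structure IsEquivalenceData {ArrG ObjG ArrH ObjH X : Type}
    (G : GroupoidData ArrG ObjG) (H : GroupoidData ArrH ObjH)
    (rX : X → ObjG) (sX : X → ObjH)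
    (lact : ArrG → X → X) (ract : X → ArrH → X) : Prop where
  left_action : IsLeftActionOf G rX lact
  right_action : IsRightActionOf H sX ract
  commute : ∀ γ x η, G.s γ = rX x → sX x = H.r η →
    ract (lact γ x) η = lact γ (ract x η)
  rX_ract : ∀ x η, sX x = H.r η → rX (ract x η) = rX x
  sX_lact : ∀ γ x, G.s γ = rX x → sX (lact γ x) = sX x
  free_left : ∀ γ x, G.s γ = rX x → lact γ x = x → γ = G.unit (rX x)
  free_right : ∀ x η, sX x = H.r η → ract x η = x → η = H.unit (sX x)
  rX_fibres : ∀ x y, rX x = rX y ↔ ∃ η, sX x = H.r η ∧ ract x η = y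
  sX_fibres : ∀ x y, sX x = sX y ↔ ∃ γ, G.s γ = rX x ∧ lact γ x = y
  rX_surj : Function.Surjective rX
  sX_surj : Function.Surjective sX

/-- Continuity of the structure maps of a topological groupoid. -/
structure IsTopologicalGroupoid {Arr Obj : Type} [TopologicalSpace Arr]
    [TopologicalSpace Obj] (D : GroupoidData Arr Obj) : Prop where
  continuous_r : Continuous D.r
  continuous_s : Continuous D.s
  continuous_unit : Continuous D.unit
  continuous_inv : Continuous D.inv
  continuous_comp : Continuous fun p : {q : Arr × Arr // D.s q.1 = D.r q.2} =>
    D.comp p.val.1 p.val.2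

/-- A Haar system for groupoid data `D`, relative to a set `Real` of
"genuine" arrows (take `Real = Set.univ` for an honest groupoid): a family
of Radon measures `κ u`, `u` a unit, with support exactly the genuine arrows
with range `u`, left invariant, and continuous against compactly supported
continuous functions. -/
def IsHaarSystemOn {Arr Obj : Type} [TopologicalSpace Arr] [TopologicalSpace Obj]
    [MeasurableSpace Arr] (D : GroupoidData Arr Obj) (Real : Set Arr)
    (κ : Obj → MeasureTheory.Measure Arr) : Prop :=
  (∀ u, κ u ({a | D.r a = u} ∩ Real)ᶜ = 0) ∧
  (∀ u U, IsOpen U → (U ∩ ({a | D.r a = u} ∩ Real)).Nonempty → 0 < κ u U) ∧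
  (∀ u K, IsCompact K → κ u K < ⊤) ∧
  (∀ a ∈ Real, ∀ f : Arr → ℝ, Continuous f → HasCompactSupport f →
    ∫ b, f (D.comp a b) ∂(κ (D.s a)) = ∫ b, f b ∂(κ (D.r a))) ∧
  (∀ f : Arr → ℝ, Continuous f → HasCompactSupport f →
    Continuous fun u => ∫ b, f b ∂(κ u))

/-- The measure `ν = μ ∘ κ` on the arrows induced by a measure `μ` on the
units and a Haar system `κ`. -/
noncomputable def nuMeasure {Arr Obj : Type} [MeasurableSpace Arr] [MeasurableSpace Obj]
    (κ : Obj → MeasureTheory.Measure Arr) (μ : MeasureTheory.Measure Obj) :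
    MeasureTheory.Measure Arr :=
  μ.bind κ

/-- Quasi-invariance of a measure `μ` on the unit space: `ν = μ∘κ` is
equivalent to its image under the inversion map. -/
def IsQuasiInvariant {Arr Obj : Type} [MeasurableSpace Arr] [MeasurableSpace Obj]
    (κ : Obj → MeasureTheory.Measure Arr) (inv : Arr → Arr)
    (μ : MeasureTheory.Measure Obj) : Prop :=
  nuMeasure κ μ ≪ (nuMeasure κ μ).map inv ∧ (nuMeasure κ μ).map inv ≪ nuMeasure κ μ


section EquivalenceSetting

variable {ArrG ObjG ArrH ObjH X : Type}

/-- The topological conditions making `X` a `(G,H)`-equivalence of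
topological groupoids: both groupoids are topological, the algebraic
equivalence conditions hold, the moment maps are continuous open surjections,
and the two actions are continuous and proper. -/
structure IsTopEquivalence [TopologicalSpace ArrG] [TopologicalSpace ObjG]
    [TopologicalSpace ArrH] [TopologicalSpace ObjH] [TopologicalSpace X]
    (G : GroupoidData ArrG ObjG) (H : GroupoidData ArrH ObjH)
    (rX : X → ObjG) (sX : X → ObjH)
    (lact : ArrG → X → X) (ract : X → ArrH → X) : Prop where
  G_groupoid : G.IsGroupoid
  H_groupoid : H.IsGroupoid
  G_top : IsTopologicalGroupoid G
  H_top : IsTopologicalGroupoid H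
  equivalence : IsEquivalenceData G H rX sX lact ract
  continuous_rX : Continuous rX
  continuous_sX : Continuous sX
  open_rX : IsOpenMap rX
  open_sX : IsOpenMap sX
  continuous_lact : Continuous fun p : {q : ArrG × X // G.s q.1 = rX q.2} =>
    lact p.val.1 p.val.2
  continuous_ract : Continuous fun p : {q : X × ArrH // sX q.1 = H.r q.2} =>
    ract p.val.1 p.val.2
  proper_lact : IsProperMap fun p : {q : ArrG × X // G.s q.1 = rX q.2} =>
    (lact p.val.1 p.val.2, p.val.2)
  proper_ract : IsProperMap fun p : {q : X × ArrH // sX q.1 = H.r q.2} =>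
    (ract p.val.1 p.val.2, p.val.2)

/-- The iterated transformation groupoid `E = G ⋉ X ⋊ H` (realized on the
ambient product; the genuine arrows form the set `ECond`). -/
def EData (G : GroupoidData ArrG ObjG) (H : GroupoidData ArrH ObjH)
    (rX : X → ObjG) (sX : X → ObjH)
    (lact : ArrG → X → X) (ract : X → ArrH → X) :
    GroupoidData (ArrG × X × ArrH) X where
  r := fun a => a.2.1
  s := fun a => ract (lact (G.inv a.1) a.2.1) a.2.2
  unit := fun x => (G.unit (rX x), x, H.unit (sX x))
  comp := fun a b => (G.comp a.1 b.1, a.2.1, H.comp a.2.2 b.2.2)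
  inv := fun a => (G.inv a.1, ract (lact (G.inv a.1) a.2.1) a.2.2, H.inv a.2.2)

/-- The set of genuine arrows of `E = G ⋉ X ⋊ H`:
`{(γ,x,η) : r(γ) = r_X(x), s_X(x) = r(η)}`. -/
def ECond (G : GroupoidData ArrG ObjG) (H : GroupoidData ArrH ObjH)
    (rX : X → ObjG) (sX : X → ObjH) : Set (ArrG × X × ArrH) :=
  {a | G.r a.1 = rX a.2.1 ∧ sX a.2.1 = H.r a.2.2}

/-- The transformation groupoid `Ḡ = G ⋉ X` (realized on the ambient
product; genuine arrows form `GbarCond`). -/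
def GbarData (G : GroupoidData ArrG ObjG) (rX : X → ObjG)
    (lact : ArrG → X → X) : GroupoidData (ArrG × X) X where
  r := fun p => p.2
  s := fun p => lact (G.inv p.1) p.2
  unit := fun x => (G.unit (rX x), x)
  comp := fun p q => (G.comp p.1 q.1, p.2)
  inv := fun p => (G.inv p.1, lact (G.inv p.1) p.2)

/-- Genuine arrows of `Ḡ = G ⋉ X`. -/
def GbarCond (G : GroupoidData ArrG ObjG) (rX : X → ObjG) : Set (ArrG × X) :=
  {p | G.r p.1 = rX p.2}

/-- The transformation groupoid `H̄ = X ⋊ H` (realized on the ambient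
product; genuine arrows form `HbarCond`). -/
def HbarData (H : GroupoidData ArrH ObjH) (sX : X → ObjH)
    (ract : X → ArrH → X) : GroupoidData (X × ArrH) X where
  r := fun p => p.1
  s := fun p => ract p.1 p.2
  unit := fun x => (x, H.unit (sX x))
  comp := fun p q => (p.1, H.comp p.2 q.2)
  inv := fun p => (ract p.1 p.2, H.inv p.2)

/-- Genuine arrows of `H̄ = X ⋊ H`. -/
def HbarCond (H : GroupoidData ArrH ObjH) (sX : X → ObjH) : Set (X × ArrH) :=
  {p | sX p.1 = H.r p.2}

variable [MeasurableSpace ArrG] [MeasurableSpace ArrH] [MeasurableSpace X]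

/-- The canonical Haar system `λ_E^x = λ^{r_X(x)} × δ_x × σ^{s_X(x)}` on
`E = G ⋉ X ⋊ H`. -/
noncomputable def EHaar (lamG : ObjG → MeasureTheory.Measure ArrG)
    (sigH : ObjH → MeasureTheory.Measure ArrH) (rX : X → ObjG) (sX : X → ObjH) :
    X → MeasureTheory.Measure (ArrG × X × ArrH) := fun x =>
  (lamG (rX x)).prod ((MeasureTheory.Measure.dirac x).prod (sigH (sX x)))

/-- The Haar system `λ^{r_X(x)} × δ_x` on `Ḡ = G ⋉ X`. -/
noncomputable def GbarHaar (lamG : ObjG → MeasureTheory.Measure ArrG)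
    (rX : X → ObjG) : X → MeasureTheory.Measure (ArrG × X) := fun x =>
  (lamG (rX x)).prod (MeasureTheory.Measure.dirac x)

/-- The Haar system `δ_x × σ^{s_X(x)}` on `H̄ = X ⋊ H`. -/
noncomputable def HbarHaar (sigH : ObjH → MeasureTheory.Measure ArrH)
    (sX : X → ObjH) : X → MeasureTheory.Measure (X × ArrH) := fun x =>
  (MeasureTheory.Measure.dirac x).prod (sigH (sX x))

end EquivalenceSetting


open ProbabilityTheory

section NullSets

variable {A B X : Type} [MeasurableSpace A] [MeasurableSpace B] [MeasurableSpace X]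

/-- A measurable right action of arrows `A` on `X`, with composition `c`, inversion `iv` and a
left-invariant kernel `κ`, all identities holding almost everywhere. -/
structure IsMeasurableActionSystem (κ : Kernel X A) (t : X → A → X) (c : A → A → A)
    (iv : A → A) : Prop where
  measurable_act : Measurable fun p : X × A => t p.1 p.2
  measurable_comp : Measurable fun p : A × A => c p.1 p.2
  measurable_inv : Measurable iv
  ne_zero : ∀ x, κ x ≠ 0
  map_comp : ∀ x, ∀ᵐ γ ∂κ x, (κ (t x γ)).map (c γ) = κ x
  act_comp : ∀ x, ∀ᵐ γ ∂κ x, ∀ᵐ α ∂κ (t x γ), t (t x γ) α = t x (c γ α)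
  inv_comp_comp : ∀ x, ∀ᵐ γ ∂κ x, ∀ᵐ α ∂κ (t x γ),
    c (iv (c γ α)) γ = iv α ∧ c (iv γ) (c γ α) = α

lemma measurableSet_ae_kernel {κ : Kernel X A} [IsSFiniteKernel κ] {p : X × A → Prop}
    (hp : MeasurableSet {z | p z}) : MeasurableSet {x | ∀ᵐ a ∂κ x, p (x, a)} :=
  Kernel.measurable_kernel_prodMk_left hp.compl (measurableSet_singleton 0)

lemma ae_const_iff {m : Measure A} (hm : m ≠ 0) {p : Prop} : (∀ᵐ _ ∂m, p) ↔ p := by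
  have : (ae m).NeBot := ae_neBot.2 hm
  exact eventually_const

variable {κ : Kernel X A} {t : X → A → X} {c : A → A → A} {iv : A → A}
  {κ' : Kernel X B} {t' : X → B → X} {c' : B → B → B} {iv' : B → B}
  {μ : Measure X}

lemma IsMeasurableActionSystem.ae_translate_iff (h : IsMeasurableActionSystem κ t c iv) (x : X) :
    ∀ᵐ γ ∂κ x, ∀ p : A → Prop, MeasurableSet {a | p a} →
      ((∀ᵐ α ∂κ (t x γ), p (c γ α)) ↔ ∀ᵐ β ∂κ x, p β) := by
  filter_upwards [h.map_comp x] with γ hγ p hp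
  have hc : Measurable (c γ) := h.measurable_comp.comp measurable_prodMk_left
  rw [← ae_map_iff hc.aemeasurable hp, hγ]

/-- If the null sets of `μ` are exactly the sets that almost every translate avoids, then `μ` is
quasi-invariant. -/
lemma IsMeasurableActionSystem.ae_inv_iff [IsSFiniteKernel κ]
    (h : IsMeasurableActionSystem κ t c iv)
    (hμ : ∀ N : Set X, MeasurableSet N →
      ((∀ᵐ x ∂μ, x ∈ N) ↔ ∀ᵐ x ∂μ, ∀ᵐ γ ∂κ x, t x γ ∈ N))
    {p : X × A → Prop} (hp : MeasurableSet {z | p z}) :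
    (∀ᵐ x ∂μ, ∀ᵐ γ ∂κ x, p (x, γ)) ↔ ∀ᵐ x ∂μ, ∀ᵐ γ ∂κ x, p (t x γ, iv γ) := by
  have ht := h.measurable_act
  have hc := h.measurable_comp
  have hi := h.measurable_inv
  have hinv : MeasurableSet {z : X × A | p (t z.1 z.2, iv z.2)} :=
    (ht.prodMk (hi.comp measurable_snd)) hp
  have hsec (x : X) : MeasurableSet {z : A × A | p (t x z.2, c (iv z.2) z.1)} :=
    ((ht.comp (measurable_const.prodMk measurable_snd)).prodMk
      (hc.comp ((hi.comp measurable_snd).prodMk measurable_fst))) hp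
  refine (hμ _ (measurableSet_ae_kernel (κ := κ) hp)).trans
    (Iff.trans ?_ (hμ _ (measurableSet_ae_kernel (κ := κ) hinv)).symm)
  refine eventually_congr (.of_forall fun x => ?_)
  have hleft : (∀ᵐ γ ∂κ x, t x γ ∈ {y | ∀ᵐ α ∂κ y, p (y, α)}) ↔
      ∀ᵐ β ∂κ x, ∀ᵐ γ ∂κ x, p (t x β, c (iv β) γ) := by
    refine eventually_congr ?_
    filter_upwards [h.ae_translate_iff x, h.inv_comp_comp x] with β hβ hβ'
    rw [← hβ (fun γ => p (t x β, c (iv β) γ)) (measurable_prodMk_right (hsec x))]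
    refine eventually_congr ?_
    filter_upwards [hβ'] with α hα
    rw [hα.2]
  have hright : (∀ᵐ γ ∂κ x, t x γ ∈ {y | ∀ᵐ α ∂κ y, p (t y α, iv α)}) ↔
      ∀ᵐ γ ∂κ x, ∀ᵐ β ∂κ x, p (t x β, c (iv β) γ) := by
    refine eventually_congr ?_
    filter_upwards [h.ae_translate_iff x, h.inv_comp_comp x, h.act_comp x] with γ hγ hγ' hγ''
    rw [← hγ (fun β => p (t x β, c (iv β) γ)) (measurable_prodMk_left (hsec x))]
    refine eventually_congr ?_
    filter_upwards [hγ', hγ''] with α hα hα'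
    rw [hα.1, hα']
  rw [hleft, hright]
  exact (Measure.ae_ae_comm (hsec x)).symm

/-- Quasi-invariance under two commuting actions together forces the null sets of `μ` to be
exactly the sets avoided by almost every translate under the second action. -/
lemma ae_mem_iff_ae_act_mem [IsSFiniteKernel κ'] (h : IsMeasurableActionSystem κ t c iv)
    (h' : IsMeasurableActionSystem κ' t' c' iv')
    (hker : ∀ x, ∀ᵐ γ ∂κ x, κ' (t x γ) = κ' x)
    (hcancel : ∀ x, ∀ᵐ γ ∂κ x, ∀ᵐ η ∂κ' x, t (t' (t x γ) η) (iv γ) = t' x η)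
    (hE : ∀ p : A × X × B → Prop, MeasurableSet {z | p z} →
      ((∀ᵐ x ∂μ, ∀ᵐ γ ∂κ x, ∀ᵐ η ∂κ' x, p (γ, x, η)) ↔
        ∀ᵐ x ∂μ, ∀ᵐ γ ∂κ x, ∀ᵐ η ∂κ' x, p (iv γ, t' (t x γ) η, iv' η)))
    (N : Set X) (hN : MeasurableSet N) :
    (∀ᵐ x ∂μ, x ∈ N) ↔ ∀ᵐ x ∂μ, ∀ᵐ η ∂κ' x, t' x η ∈ N := by
  have ht := h.measurable_act
  have ht' := h'.measurable_act
  have hM : MeasurableSet {y | ∀ᵐ η ∂κ' y, t' y η ∈ N} :=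
    measurableSet_ae_kernel (κ := κ') (p := fun z => t' z.1 z.2 ∈ N) (ht' hN)
  calc (∀ᵐ x ∂μ, x ∈ N)
      ↔ ∀ᵐ x ∂μ, ∀ᵐ _γ ∂κ x, ∀ᵐ _η ∂κ' x, x ∈ N := by
        simp only [ae_const_iff (h.ne_zero _), ae_const_iff (h'.ne_zero _)]
    _ ↔ ∀ᵐ x ∂μ, ∀ᵐ γ ∂κ x, ∀ᵐ η ∂κ' x, t' (t x γ) η ∈ N :=
        hE (fun z => z.2.1 ∈ N) ((measurable_fst.comp measurable_snd) hN)
    _ ↔ ∀ᵐ x ∂μ, ∀ᵐ γ ∂κ x, ∀ᵐ _η ∂κ' x, t x γ ∈ {y | ∀ᵐ η ∂κ' y, t' y η ∈ N} := by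
        refine eventually_congr (.of_forall fun x => eventually_congr ?_)
        filter_upwards [hker x] with γ hγ
        rw [ae_const_iff (h'.ne_zero _)]
        rw [hγ]
    _ ↔ ∀ᵐ x ∂μ, ∀ᵐ γ ∂κ x, ∀ᵐ η ∂κ' x,
          t (t' (t x γ) η) (iv γ) ∈ {y | ∀ᵐ η ∂κ' y, t' y η ∈ N} :=
        hE (fun z => t z.2.1 z.1 ∈ {y | ∀ᵐ η ∂κ' y, t' y η ∈ N})
          ((ht.comp ((measurable_fst.comp measurable_snd).prodMk measurable_fst)) hM)
    _ ↔ ∀ᵐ x ∂μ, ∀ᵐ η ∂κ' x, t' x η ∈ {y | ∀ᵐ η ∂κ' y, t' y η ∈ N} := by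
        refine eventually_congr (.of_forall fun x => ?_)
        rw [← ae_const_iff (p := ∀ᵐ η ∂κ' x, t' x η ∈ {y | ∀ᵐ η ∂κ' y, t' y η ∈ N})
          (h.ne_zero x)]
        refine eventually_congr ?_
        filter_upwards [hcancel x] with γ hγ
        refine eventually_congr ?_
        filter_upwards [hγ] with η hη
        rw [hη]
    _ ↔ ∀ᵐ x ∂μ, ∀ᵐ η ∂κ' x, t' x η ∈ N := by
        refine eventually_congr (.of_forall fun x => ?_)
        rw [← ae_const_iff (p := ∀ᵐ η ∂κ' x, t' x η ∈ N) (h'.ne_zero x)]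
        refine eventually_congr ?_
        filter_upwards [h'.ae_translate_iff x, h'.act_comp x] with η hη hη'
        rw [← hη (fun ζ => t' x ζ ∈ N) ((ht'.comp measurable_prodMk_left) hN)]
        refine eventually_congr ?_
        filter_upwards [hη'] with ζ hζ
        rw [hζ]

end NullSets

section ContinuousFamilies

variable {A X : Type} [TopologicalSpace A] [T2Space A] [SecondCountableTopology A]
  [LocallyCompactSpace A] [MeasurableSpace A] [BorelSpace A]
  [TopologicalSpace X] [MeasurableSpace X] [BorelSpace X] {m : X → Measure A}

lemma measurable_measure_isOpen_of_continuous_integral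
    (hfin : ∀ x K, IsCompact K → m x K < ⊤)
    (hcont : ∀ f : A → ℝ, Continuous f → HasCompactSupport f →
      Continuous fun x => ∫ a, f a ∂m x) {U : Set A} (hU : IsOpen U) :
    Measurable fun x => m x U := by
  have : LocallyCompactSpace U := hU.locallyCompactSpace
  have hKc (n : ℕ) : IsCompact (Subtype.val '' compactCovering U n) :=
    (isCompact_compactCovering U n).image continuous_subtype_val
  have hKU (n : ℕ) : Subtype.val '' compactCovering U n ⊆ U := by
    rintro _ ⟨y, -, rfl⟩
    exact y.2
  have hKun : ⋃ n, Subtype.val '' compactCovering U n = U := by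
    rw [← Set.image_iUnion, iUnion_compactCovering, Set.image_univ, Subtype.range_coe]
  choose f hf1 hfc hfU hf01 using fun n =>
    exists_continuousMap_one_of_isCompact_subset_isOpen (hKc n) hU (hKU n)
  have hmono : Monotone fun n => (Subtype.val '' compactCovering U n : Set A) :=
    fun i j hij => Set.image_mono (compactCovering_subset U hij)
  have key (x : X) : m x U = ⨆ n, ENNReal.ofReal (∫ a, f n a ∂m x) := by
    have : IsFiniteMeasureOnCompacts (m x) := ⟨fun K hK => hfin x K hK⟩
    have hint (n : ℕ) : ENNReal.ofReal (∫ a, f n a ∂m x) = ∫⁻ a, ENNReal.ofReal (f n a) ∂m x :=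
      ofReal_integral_eq_lintegral_ofReal ((f n).continuous.integrable_of_hasCompactSupport (hfc n))
        (.of_forall fun a => (hf01 n a).1)
    apply le_antisymm
    · conv_lhs => rw [← hKun, hmono.measure_iUnion]
      refine iSup_mono fun n => ?_
      rw [hint, ← lintegral_indicator_one (hKc n).measurableSet]
      refine lintegral_mono fun a => ?_
      by_cases ha : a ∈ (Subtype.val '' compactCovering U n : Set A)
      · simp [ha, hf1 n ha]
      · simp [ha]
    · refine iSup_le fun n => ?_
      rw [hint, ← lintegral_indicator_one hU.measurableSet]
      refine lintegral_mono fun a => ?_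
      by_cases ha : a ∈ U
      · simp [ha, (hf01 n a).2]
      · have : f n a = 0 := image_eq_zero_of_notMem_tsupport fun h => ha (hfU n h)
        simp [ha, this]
  simp_rw [key]
  exact .iSup fun n => (hcont _ (f n).continuous (hfc n)).measurable.ennreal_ofReal

lemma measurable_of_continuous_integral
    (hfin : ∀ x K, IsCompact K → m x K < ⊤)
    (hcont : ∀ f : A → ℝ, Continuous f → HasCompactSupport f →
      Continuous fun x => ∫ a, f a ∂m x) : Measurable m := by
  have hopen {U : Set A} (hU : IsOpen U) : Measurable fun x => m x U :=
    measurable_measure_isOpen_of_continuous_integral hfin hcont hU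
  let K : CompactExhaustion A := default
  have hVK (n : ℕ) : interior (K n) ⊆ K n := interior_subset
  have hres (n : ℕ) : Measurable fun x => (m x).restrict (interior (K n)) := by
    have (x : X) : IsFiniteMeasure ((m x).restrict (interior (K n))) :=
      ⟨by simpa using (measure_mono (hVK n)).trans_lt (hfin x _ (K.isCompact n))⟩
    refine Measurable.measure_of_isPiSystem (BorelSpace.measurable_eq (α := A))
      isPiSystem_isOpen (fun U hU => ?_) ?_
    · simp_rw [Measure.restrict_apply (IsOpen.measurableSet hU)]
      exact hopen (IsOpen.inter hU isOpen_interior)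
    · simpa using hopen isOpen_interior
  refine Measure.measurable_of_measurable_coe _ fun S hS => ?_
  have hcover : ⋃ n, interior (K n) = Set.univ :=
    Set.eq_univ_of_forall fun a => Set.mem_iUnion.2 ⟨K.find a + 1,
      K.subset_interior_succ _ (K.mem_find a)⟩
  have hun : ⋃ n, S ∩ interior (K n) = S := by
    rw [← Set.inter_iUnion, hcover, Set.inter_univ]
  have hmono : Monotone fun n => S ∩ interior (K n) :=
    fun i j hij => Set.inter_subset_inter_right _ (interior_mono (K.subset hij))
  have key (x : X) : m x S = ⨆ n, (m x).restrict (interior (K n)) S := by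
    conv_lhs => rw [← hun, hmono.measure_iUnion]
    simp_rw [Measure.restrict_apply hS]
  simp_rw [key]
  exact .iSup fun n => (Measure.measurable_coe hS).comp (hres n)

end ContinuousFamilies

lemma ProbabilityTheory.Kernel.isSFiniteKernel_of_forall_lt_top {A X : Type} [MeasurableSpace A]
    [MeasurableSpace X] (κ : Kernel X A) {D : ℕ → Set A} (hD : ∀ n, MeasurableSet (D n))
    (hdisj : Pairwise (Function.onFun Disjoint D)) (hun : ⋃ n, D n = Set.univ)
    (hfin : ∀ x n, κ x (D n) < ⊤) : IsSFiniteKernel κ := by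
  classical
  have hmeas (n : ℕ) : Measurable fun x => κ x (D n) := κ.measurable_coe (hD n)
  have hlevel (n k : ℕ) : MeasurableSet {x | ⌊(κ x (D n)).toReal⌋₊ = k} :=
    ((Nat.measurable_floor.comp (hmeas n).ennreal_toReal) (measurableSet_singleton k))
  let piece (p : ℕ × ℕ) : Kernel X A :=
    Kernel.piecewise (hlevel p.1 p.2) (κ.restrict (hD p.1)) 0
  have hpiece (p : ℕ × ℕ) : IsFiniteKernel (piece p) := by
    refine ⟨⟨(p.2 + 1 : ℕ), ENNReal.natCast_lt_top _, fun x => ?_⟩⟩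
    by_cases hx : x ∈ {x | ⌊(κ x (D p.1)).toReal⌋₊ = p.2}
    · simp only [piece, Kernel.piecewise_apply, hx, if_true, Kernel.restrict_apply,
        Measure.restrict_apply_univ]
      rw [← ENNReal.ofReal_toReal (hfin x p.1).ne, ← ENNReal.ofReal_natCast]
      refine ENNReal.ofReal_le_ofReal ?_
      have hx' : ⌊(κ x (D p.1)).toReal⌋₊ = p.2 := hx
      rw [← hx']
      push_cast
      exact (Nat.lt_floor_add_one _).le
    · simp [piece, Kernel.piecewise_apply, hx]
  have hsum : κ = Kernel.sum piece := by
    ext x S hS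
    rw [Kernel.sum_apply' _ _ hS, ENNReal.tsum_prod (f := fun n k => piece (n, k) x S)]
    have hinner (n : ℕ) : ∑' k, piece (n, k) x S = κ x (S ∩ D n) := by
      rw [tsum_eq_single ⌊(κ x (D n)).toReal⌋₊]
      · simp [piece, Kernel.piecewise_apply, Kernel.restrict_apply, Measure.restrict_apply hS]
      · intro k hk
        simp [piece, Kernel.piecewise_apply, hk.symm]
    simp_rw [hinner]
    rw [← measure_iUnion (fun i j hij => (hdisj hij).mono Set.inter_subset_right
      Set.inter_subset_right) fun n => hS.inter (hD n), ← Set.inter_iUnion, hun, Set.inter_univ]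
  rw [hsum]
  exact Kernel.isSFiniteKernel_sum

namespace GroupoidData.IsGroupoid

variable {A O : Type} {D : GroupoidData A O}

lemma inv_comp_cancel (hD : D.IsGroupoid) {a b : A} (h : D.s a = D.r b) :
    D.comp (D.inv a) (D.comp a b) = b := by
  rw [← hD.comp_assoc _ _ _ (hD.s_inv a) h, hD.inv_comp, h, hD.unit_comp]

lemma comp_inv_cancel (hD : D.IsGroupoid) {a b : A} (h : D.s a = D.r b) :
    D.comp (D.comp a b) (D.inv b) = a := by
  rw [hD.comp_assoc _ _ _ h (hD.r_inv b).symm, hD.comp_inv, ← h, hD.comp_unit]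

lemma inv_comp_comp (hD : D.IsGroupoid) {a b : A} (h : D.s a = D.r b) :
    D.comp (D.inv (D.comp a b)) a = D.inv b := by
  have hcancel := hD.inv_comp_cancel ((hD.s_comp _ _ h).trans (hD.r_inv b).symm)
  rwa [hD.comp_inv_cancel h] at hcancel

lemma inv_comp_rev (hD : D.IsGroupoid) {a b : A} (h : D.s a = D.r b) :
    D.inv (D.comp a b) = D.comp (D.inv b) (D.inv a) := by
  have hs : D.s (D.inv (D.comp a b)) = D.r a := (hD.s_inv _).trans (hD.r_comp _ _ h)
  rw [← hD.inv_comp_comp h, hD.comp_assoc _ _ _ hs (hD.r_inv a).symm, hD.comp_inv, ← hs,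
    hD.comp_unit]

lemma inv_unit (hD : D.IsGroupoid) (u : O) : D.inv (D.unit u) = D.unit u := by
  have h := hD.comp_unit (D.inv (D.unit u))
  rwa [hD.s_inv, hD.r_unit, hD.inv_comp, hD.s_unit, eq_comm] at h

end GroupoidData.IsGroupoid

/-- A left action read as a right action through inversion. -/
lemma IsLeftActionOf.toRight {A O X : Type} {G : GroupoidData A O} {rX : X → O}
    {lact : A → X → X} (hG : G.IsGroupoid) (h : IsLeftActionOf G rX lact) :
    IsRightActionOf G rX fun x γ => lact (G.inv γ) x where
  moment x γ hx := (h.moment _ _ ((hG.s_inv γ).trans hx.symm)).trans (hG.r_inv γ)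
  unit_act x := by simp only [hG.inv_unit, h.unit_act]
  comp_act x γ α hx hγ := by
    simp only [hG.inv_comp_rev hγ]
    exact h.comp_act _ _ _ ((hG.s_inv α).trans (hγ.symm.trans (hG.r_inv γ).symm))
      ((hG.s_inv γ).trans hx.symm)

open Classical in
/-- The extension of a right action by the identity outside its domain. -/
noncomputable def totalAct {A O X : Type} (H : GroupoidData A O) (sX : X → O)
    (ract : X → A → X) (x : X) (η : A) : X :=
  if sX x = H.r η then ract x η else x

lemma totalAct_of_eq {A O X : Type} {H : GroupoidData A O} {sX : X → O}
    {ract : X → A → X} {x : X} {η : A} (h : sX x = H.r η) :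
    totalAct H sX ract x η = ract x η := if_pos h

lemma measurable_totalAct {A O X : Type} [TopologicalSpace A] [SecondCountableTopology A]
    [MeasurableSpace A] [BorelSpace A] [TopologicalSpace O] [T2Space O]
    [TopologicalSpace X] [SecondCountableTopology X] [MeasurableSpace X] [BorelSpace X]
    {H : GroupoidData A O} {sX : X → O} {ract : X → A → X} (hr : Continuous H.r)
    (hsX : Continuous sX)
    (hract : Continuous fun p : {q : X × A // sX q.1 = H.r q.2} => ract p.val.1 p.val.2) :
    Measurable fun p : X × A => totalAct H sX ract p.1 p.2 := by
  have hS : MeasurableSet {q : X × A | sX q.1 = H.r q.2} :=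
    (isClosed_eq (hsX.comp continuous_fst) (hr.comp continuous_snd)).measurableSet
  refine measurable_of_restrict_of_restrict_compl hS ?_ ?_
  · have heq : ({q : X × A | sX q.1 = H.r q.2}.domRestrict
        fun p => totalAct H sX ract p.1 p.2) = fun p => ract p.val.1 p.val.2 :=
      funext fun p => totalAct_of_eq p.2
    rw [heq]
    exact hract.measurable
  · convert measurable_fst.comp measurable_subtype_coe using 1
    funext p
    exact if_neg p.2

namespace IsHaarSystemOn

variable {A O : Type} [TopologicalSpace A] [MeasurableSpace A] [TopologicalSpace O]
  {H : GroupoidData A O} {σ : O → Measure A}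

lemma ae_r_eq (hσ : IsHaarSystemOn H Set.univ σ) (u : O) : ∀ᵐ a ∂σ u, u = H.r a := by
  have h := hσ.1 u
  rw [Set.inter_univ] at h
  filter_upwards [compl_mem_ae_iff.2 h] with a ha
  simpa [eq_comm] using ha

lemma ne_zero (hH : H.IsGroupoid) (hσ : IsHaarSystemOn H Set.univ σ) (u : O) : σ u ≠ 0 := by
  intro h
  have := hσ.2.1 u Set.univ isOpen_univ ⟨H.unit u, by simp [hH.r_unit]⟩
  simp [h] at this

end IsHaarSystemOn

section HaarSystems

variable {A O X : Type} [TopologicalSpace A] [T2Space A] [SecondCountableTopology A]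
  [LocallyCompactSpace A] [MeasurableSpace A] [BorelSpace A] [TopologicalSpace O] [T2Space O]
  {H : GroupoidData A O} {σ : O → Measure A}

namespace IsHaarSystemOn

lemma map_comp (hH : H.IsGroupoid) (hHt : IsTopologicalGroupoid H)
    (hσ : IsHaarSystemOn H Set.univ σ) (a : A) :
    (σ (H.s a)).map (totalAct H H.s H.comp a) = σ (H.r a) := by
  have hfin (u : O) : IsFiniteMeasureOnCompacts (σ u) := ⟨fun K hK => hσ.2.2.1 u K hK⟩
  have hmeas : Measurable (totalAct H H.s H.comp a) :=
    (measurable_totalAct hHt.continuous_r hHt.continuous_s hHt.continuous_comp).comp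
      measurable_prodMk_left
  have hcompact : IsFiniteMeasureOnCompacts ((σ (H.s a)).map (totalAct H H.s H.comp a)) := by
    refine ⟨fun K hK => ?_⟩
    rw [Measure.map_apply hmeas hK.measurableSet]
    have hL : IsCompact (K ∩ {b | H.r a = H.r b}) :=
      hK.inter_right (isClosed_eq continuous_const hHt.continuous_r)
    have hcont : ContinuousOn (H.comp (H.inv a)) (K ∩ {b | H.r a = H.r b}) := by
      rw [continuousOn_iff_continuous_domRestrict]
      exact hHt.continuous_comp.comp (Continuous.subtype_mk
        (continuous_const.prodMk continuous_subtype_val) fun b => (hH.s_inv a).trans b.2.2)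
    refine (measure_mono_ae ?_).trans_lt (hσ.2.2.1 (H.s a) _ (hL.image_of_continuousOn hcont))
    filter_upwards [hσ.ae_r_eq (H.s a)] with b hb hbK
    have hbK' : H.comp a b ∈ K := by
      have : totalAct H H.s H.comp a b ∈ K := hbK
      rwa [totalAct_of_eq hb] at this
    exact ⟨H.comp a b, ⟨hbK', (hH.r_comp _ _ hb).symm⟩, hH.inv_comp_cancel hb⟩
  refine Measure.ext_of_integral_eq_on_compactlySupported fun f => ?_
  rw [integral_map hmeas.aemeasurable (map_continuous f).aestronglyMeasurable,
    ← hσ.2.2.2.1 a (Set.mem_univ a) f (map_continuous f) f.hasCompactSupport]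
  refine integral_congr_ae ?_
  filter_upwards [hσ.ae_r_eq (H.s a)] with b hb
  rw [totalAct_of_eq hb]

variable [TopologicalSpace X] [SecondCountableTopology X] [MeasurableSpace X] [BorelSpace X]
  {sX : X → O} {ract : X → A → X}

/-- The kernel `x ↦ σ^{s_X(x)}` of a Haar system pulled back along a moment map. -/
noncomputable def kernel (hσ : IsHaarSystemOn H Set.univ σ) (hsX : Continuous sX) :
    Kernel X A :=
  ⟨fun x => σ (sX x), measurable_of_continuous_integral (fun _ K hK => hσ.2.2.1 _ K hK)
    fun f hf hf' => (hσ.2.2.2.2 f hf hf').comp hsX⟩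

instance (hσ : IsHaarSystemOn H Set.univ σ) (hsX : Continuous sX) :
    IsSFiniteKernel (hσ.kernel hsX) := by
  refine Kernel.isSFiniteKernel_of_forall_lt_top _ (D := disjointed (compactCovering A))
    (fun n => .disjointed (fun i => (isCompact_compactCovering A i).measurableSet) n)
    (disjoint_disjointed _) ?_ fun x n => ?_
  · rw [iUnion_disjointed, iUnion_compactCovering]
  · exact (measure_mono (disjointed_subset _ n)).trans_lt
      (hσ.2.2.1 (sX x) _ (isCompact_compactCovering A n))

lemma isMeasurableActionSystem (hσ : IsHaarSystemOn H Set.univ σ) (hH : H.IsGroupoid)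
    (hHt : IsTopologicalGroupoid H) (hsX : Continuous sX) (hact : IsRightActionOf H sX ract)
    (hract : Continuous fun p : {q : X × A // sX q.1 = H.r q.2} => ract p.val.1 p.val.2) :
    IsMeasurableActionSystem (hσ.kernel hsX) (totalAct H sX ract) (totalAct H H.s H.comp)
      H.inv where
  measurable_act := measurable_totalAct hHt.continuous_r hsX hract
  measurable_comp :=
    measurable_totalAct hHt.continuous_r hHt.continuous_s hHt.continuous_comp
  measurable_inv := hHt.continuous_inv.measurable
  ne_zero x := hσ.ne_zero hH (sX x)
  map_comp x := by
    filter_upwards [hσ.ae_r_eq (sX x)] with γ hγ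
    change (σ (sX (totalAct H sX ract x γ))).map _ = σ (sX x)
    rw [totalAct_of_eq hγ, hact.moment _ _ hγ, hγ, hσ.map_comp hH hHt]
  act_comp x := by
    filter_upwards [hσ.ae_r_eq (sX x)] with γ hγ
    filter_upwards [hσ.ae_r_eq (sX (totalAct H sX ract x γ))] with α hα
    have hγα : H.s γ = H.r α := by
      rw [← hact.moment _ _ hγ, ← hα, totalAct_of_eq hγ]
    rw [totalAct_of_eq hα, totalAct_of_eq hγ, totalAct_of_eq hγα,
      totalAct_of_eq (hγ.trans (hH.r_comp _ _ hγα).symm), hact.comp_act _ _ _ hγ hγα]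
  inv_comp_comp x := by
    filter_upwards [hσ.ae_r_eq (sX x)] with γ hγ
    filter_upwards [hσ.ae_r_eq (sX (totalAct H sX ract x γ))] with α hα
    have hγα : H.s γ = H.r α := by
      rw [← hact.moment _ _ hγ, ← hα, totalAct_of_eq hγ]
    have hr := hH.r_comp _ _ hγα
    rw [totalAct_of_eq hγα, totalAct_of_eq ((hH.s_inv _).trans hr),
      totalAct_of_eq ((hH.s_inv γ).trans hr.symm)]
    exact ⟨hH.inv_comp_comp hγα, hH.inv_comp_cancel hγα⟩

end IsHaarSystemOn

end HaarSystems

/-- Quasi-invariance in terms of almost everywhere statements. -/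
lemma isQuasiInvariant_iff {X Z : Type} [MeasurableSpace X] [MeasurableSpace Z]
    (K : Kernel X Z) {f g : Z → Z} (hg : Measurable g) {S : Set Z} (hS : MeasurableSet S)
    (hfg : Set.EqOn f g S) (hKS : ∀ x, ∀ᵐ z ∂K x, z ∈ S) (μ : Measure X) :
    IsQuasiInvariant K f μ ↔ ∀ p : Z → Prop, MeasurableSet {z | p z} →
      ((∀ᵐ x ∂μ, ∀ᵐ z ∂K x, p z) ↔ ∀ᵐ x ∂μ, ∀ᵐ z ∂K x, p (g z)) := by
  have hmap : (nuMeasure K μ).map f = (nuMeasure K μ).map g :=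
    Measure.map_congr (((Measure.ae_comp_iff (p := (· ∈ S)) hS).2 (.of_forall hKS)).mono hfg)
  have hν {p : Z → Prop} (hp : MeasurableSet {z | p z}) :
      (∀ᵐ z ∂nuMeasure K μ, p z) ↔ ∀ᵐ x ∂μ, ∀ᵐ z ∂K x, p z := Measure.ae_comp_iff hp
  have hν' {p : Z → Prop} (hp : MeasurableSet {z | p z}) :
      (∀ᵐ z ∂(nuMeasure K μ).map g, p z) ↔ ∀ᵐ x ∂μ, ∀ᵐ z ∂K x, p (g z) := by
    rw [ae_map_iff hg.aemeasurable hp]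
    exact hν (hg hp)
  rw [IsQuasiInvariant, hmap]
  constructor
  · rintro ⟨h₁, h₂⟩ p hp
    rw [← hν hp, ← hν' hp]
    exact ⟨fun h => h₂.ae_le h, fun h => h₁.ae_le h⟩
  · intro h
    constructor <;> refine Measure.AbsolutelyContinuous.mk fun T hT hT0 => ?_
    · rw [measure_eq_zero_iff_ae_notMem] at hT0 ⊢
      exact (hν hT.compl).2 ((h _ hT.compl).2 ((hν' hT.compl).1 hT0))
    · rw [measure_eq_zero_iff_ae_notMem] at hT0 ⊢
      exact (hν' hT.compl).2 ((h _ hT.compl).1 ((hν hT.compl).1 hT0))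

/-- Translating by `γ` and then by its inverse cancels, even across a commuting action. -/
lemma totalAct_totalAct_inv {A O B Q X : Type} {G : GroupoidData A O} {H : GroupoidData B Q}
    {rX : X → O} {sX : X → Q} {t : X → A → X} {t' : X → B → X} (hG : G.IsGroupoid)
    (ht : IsRightActionOf G rX t)
    (hsX : ∀ x γ, rX x = G.r γ → sX (t x γ) = sX x)
    (hrX : ∀ x η, sX x = H.r η → rX (t' x η) = rX x)
    (hcomm : ∀ x γ η, rX x = G.r γ → sX x = H.r η → t' (t x γ) η = t (t' x η) γ)
    {x : X} {γ : A} {η : B} (hγ : rX x = G.r γ) (hη : sX x = H.r η) :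
    totalAct G rX t (totalAct H sX t' (totalAct G rX t x γ) η) (G.inv γ) =
      totalAct H sX t' x η := by
  have hγ' : rX (t' x η) = G.r γ := (hrX x η hη).trans hγ
  have hinv : G.s γ = G.r (G.inv γ) := (hG.r_inv γ).symm
  rw [totalAct_of_eq hγ, totalAct_of_eq hη, totalAct_of_eq ((hsX x γ hγ).trans hη),
    hcomm x γ η hγ hη, totalAct_of_eq ((ht.moment _ _ hγ').trans hinv),
    ← ht.comp_act _ _ _ hγ' hinv, hG.comp_inv, ← hγ', ht.unit_act]

/-- If `μ` is a Radon measure on `X` which is quasi-invariant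
with respect to `E = G ⋉ X ⋊ H`, then `μ` is quasi-invariant with respect to
the transformation groupoids `Ḡ = G ⋉ X` and `H̄ = X ⋊ H`. -/
theorem statement6
    {ArrG ObjG ArrH ObjH X : Type}
    [TopologicalSpace ArrG] [TopologicalSpace ObjG] [TopologicalSpace ArrH]
    [TopologicalSpace ObjH] [TopologicalSpace X]
    [T2Space ArrG] [T2Space ObjG] [T2Space ArrH] [T2Space ObjH] [T2Space X]
    [SecondCountableTopology ArrG] [SecondCountableTopology ObjG]
    [SecondCountableTopology ArrH] [SecondCountableTopology ObjH]
    [SecondCountableTopology X]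
    [LocallyCompactSpace ArrG] [LocallyCompactSpace ObjG] [LocallyCompactSpace ArrH]
    [LocallyCompactSpace ObjH] [LocallyCompactSpace X]
    [MeasurableSpace ArrG] [BorelSpace ArrG] [MeasurableSpace ArrH] [BorelSpace ArrH]
    [MeasurableSpace X] [BorelSpace X] [MeasurableSpace ObjH] [BorelSpace ObjH]
    (G : GroupoidData ArrG ObjG) (H : GroupoidData ArrH ObjH)
    (rX : X → ObjG) (sX : X → ObjH) (lact : ArrG → X → X) (ract : X → ArrH → X)
    (heq : IsTopEquivalence G H rX sX lact ract)
    (lamG : ObjG → MeasureTheory.Measure ArrG)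
    (hlamG : IsHaarSystemOn G Set.univ lamG)
    (sigH : ObjH → MeasureTheory.Measure ArrH)
    (hsigH : IsHaarSystemOn H Set.univ sigH)
    (μ : MeasureTheory.Measure X) [μ.Regular]
    (hqi : IsQuasiInvariant (EHaar lamG sigH rX sX)
      (EData G H rX sX lact ract).inv μ)
    : IsQuasiInvariant (GbarHaar lamG rX) (GbarData G rX lact).inv μ ∧
      IsQuasiInvariant (HbarHaar sigH sX) (HbarData H sX ract).inv μ := by
  obtain ⟨hG, hH, hGt, hHt, hX, hrX, hsX, -, -, hl, hr, -, -⟩ := heq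
  have hactG := hX.left_action.toRight hG
  have hactH := hX.right_action
  have hl' : Continuous fun p : {q : X × ArrG // rX q.1 = G.r q.2} =>
      lact (G.inv p.val.2) p.val.1 :=
    hl.comp (Continuous.subtype_mk ((hGt.continuous_inv.comp
      (continuous_snd.comp continuous_subtype_val)).prodMk
        (continuous_fst.comp continuous_subtype_val)) fun p => (hG.s_inv _).trans p.2.symm)
  have sysG := hlamG.isMeasurableActionSystem hG hGt hrX hactG hl'
  have sysH := hsigH.isMeasurableActionSystem hH hHt hsX hactH hr
  set κG := hlamG.kernel hrX
  set κH := hsigH.kernel hsX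
  set tG := totalAct G rX fun x γ => lact (G.inv γ) x with htG
  set tH := totalAct H sX ract with htH
  have aeG (x : X) : ∀ᵐ γ ∂κG x, rX x = G.r γ := hlamG.ae_r_eq (rX x)
  have aeH (x : X) : ∀ᵐ η ∂κH x, sX x = H.r η := hsigH.ae_r_eq (sX x)
  have hsXinv (x : X) (γ : ArrG) (h : rX x = G.r γ) : sX (lact (G.inv γ) x) = sX x :=
    hX.sX_lact _ _ ((hG.s_inv γ).trans h.symm)
  have hcomm (x : X) (γ : ArrG) (η : ArrH) (hγ : rX x = G.r γ) (hη : sX x = H.r η) :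
      ract (lact (G.inv γ) x) η = lact (G.inv γ) (ract x η) :=
    hX.commute _ _ _ ((hG.s_inv γ).trans hγ.symm) hη
  have hclosedG : MeasurableSet (GbarCond G rX) :=
    (isClosed_eq (hGt.continuous_r.comp continuous_fst)
      (hrX.comp continuous_snd)).measurableSet
  have hclosedH : MeasurableSet (HbarCond H sX) :=
    (isClosed_eq (hsX.comp continuous_fst)
      (hHt.continuous_r.comp continuous_snd)).measurableSet
  have hclosedE : MeasurableSet (ECond G H rX sX) :=
    ((isClosed_eq (hGt.continuous_r.comp continuous_fst)
        (hrX.comp (continuous_fst.comp continuous_snd))).inter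
      (isClosed_eq (hsX.comp (continuous_fst.comp continuous_snd))
        (hHt.continuous_r.comp (continuous_snd.comp continuous_snd)))).measurableSet
  -- the Haar systems of the three transformation groupoids are kernels
  have hkerE : EHaar lamG sigH rX sX = ⇑(κG ×ₖ (Kernel.id ×ₖ κH)) := by
    funext x
    rw [Kernel.prod_apply, Kernel.prod_apply, Kernel.id_apply]
    rfl
  have hkerG : GbarHaar lamG rX = ⇑(κG ×ₖ Kernel.id) := by
    funext x
    rw [Kernel.prod_apply, Kernel.id_apply]
    rfl
  have hkerH : HbarHaar sigH sX = ⇑(Kernel.id ×ₖ κH) := by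
    funext x
    rw [Kernel.prod_apply, Kernel.id_apply]
    rfl
  have aeHbar (x : X) {p : X × ArrH → Prop} (hp : MeasurableSet {z | p z}) :
      (∀ᵐ z ∂(Kernel.id ×ₖ κH) x, p z) ↔ ∀ᵐ η ∂κH x, p (x, η) := by
    rw [Kernel.prod_apply, Kernel.id_apply, Measure.dirac_prod,
      ae_map_iff measurable_prodMk_left.aemeasurable hp]
  have aeGbar (x : X) {p : ArrG × X → Prop} (hp : MeasurableSet {z | p z}) :
      (∀ᵐ z ∂(κG ×ₖ Kernel.id) x, p z) ↔ ∀ᵐ γ ∂κG x, p (γ, x) := by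
    rw [Kernel.prod_apply, Kernel.id_apply, Measure.prod_dirac,
      ae_map_iff measurable_prodMk_right.aemeasurable hp]
  have aeE (x : X) {p : ArrG × X × ArrH → Prop} (hp : MeasurableSet {z | p z}) :
      (∀ᵐ z ∂(κG ×ₖ (Kernel.id ×ₖ κH)) x, p z) ↔
        ∀ᵐ γ ∂κG x, ∀ᵐ η ∂κH x, p (γ, x, η) := by
    rw [Kernel.prod_apply, Measure.ae_prod_iff_ae_ae hp]
    exact eventually_congr (.of_forall fun γ => aeHbar x (measurable_prodMk_left hp))
  have measG : Measurable fun z : ArrG × X => (G.inv z.1, tG z.2 z.1) :=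
    (sysG.measurable_inv.comp measurable_fst).prodMk
      (sysG.measurable_act.comp measurable_swap)
  have measH : Measurable fun z : X × ArrH => (tH z.1 z.2, H.inv z.2) :=
    sysH.measurable_act.prodMk (sysH.measurable_inv.comp measurable_snd)
  have measAct : Measurable fun z : ArrG × X × ArrH => tH (tG z.2.1 z.1) z.2.2 :=
    sysH.measurable_act.comp ((sysG.measurable_act.comp
      ((measurable_fst.comp measurable_snd).prodMk measurable_fst)).prodMk
        (measurable_snd.comp measurable_snd))
  have measE : Measurable fun z : ArrG × X × ArrH =>
      (G.inv z.1, tH (tG z.2.1 z.1) z.2.2, H.inv z.2.2) :=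
    (sysG.measurable_inv.comp measurable_fst).prodMk (measAct.prodMk
      (sysH.measurable_inv.comp (measurable_snd.comp measurable_snd)))
  have hE (p : ArrG × X × ArrH → Prop) (hp : MeasurableSet {z | p z}) :
      (∀ᵐ x ∂μ, ∀ᵐ γ ∂κG x, ∀ᵐ η ∂κH x, p (γ, x, η)) ↔
        ∀ᵐ x ∂μ, ∀ᵐ γ ∂κG x, ∀ᵐ η ∂κH x, p (G.inv γ, tH (tG x γ) η, H.inv η) := by
    rw [hkerE, isQuasiInvariant_iff _ measE hclosedE] at hqi
    · have h := hqi p hp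
      simp only [aeE _ hp] at h
      rw [h]
      exact eventually_congr (.of_forall fun x => aeE x (measE hp))
    · rintro ⟨γ, x, η⟩ ⟨hγ, hη⟩
      have hγ' : rX x = G.r γ := hγ.symm
      have hη' : sX (lact (G.inv γ) x) = H.r η := (hsXinv x γ hγ').trans hη
      simp only [EData, htG, htH, totalAct_of_eq hγ', totalAct_of_eq hη']
    · intro x
      rw [aeE x (p := (· ∈ ECond G H rX sX)) hclosedE]
      filter_upwards [aeG x] with γ hγ
      filter_upwards [aeH x] with η hη
      exact ⟨hγ.symm, hη⟩
  have hE' (p : ArrH × X × ArrG → Prop) (hp : MeasurableSet {z | p z}) :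
      (∀ᵐ x ∂μ, ∀ᵐ η ∂κH x, ∀ᵐ γ ∂κG x, p (η, x, γ)) ↔
        ∀ᵐ x ∂μ, ∀ᵐ η ∂κH x, ∀ᵐ γ ∂κG x, p (H.inv η, tG (tH x η) γ, G.inv γ) := by
    have hrev : Measurable fun z : ArrG × X × ArrH => (z.2.2, z.2.1, z.1) := by fun_prop
    have h := hE (fun z => p (z.2.2, z.2.1, z.1)) (hrev hp)
    have hins (x : X) : Measurable fun z : ArrG × ArrH => (z.1, x, z.2) := by fun_prop
    convert h using 1
    · refine eventually_congr (.of_forall fun x => ?_)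
      exact (Measure.ae_ae_comm (μ := κG x) (ν := κH x)
        (p := fun γ η => p (η, x, γ)) ((hrev.comp (hins x)) hp)).symm
    · refine eventually_congr (.of_forall fun x => ?_)
      refine Iff.trans ?_ (Measure.ae_ae_comm (μ := κG x) (ν := κH x)
        (p := fun γ η => p (H.inv η, tH (tG x γ) η, G.inv γ))
        (((hrev.comp measE).comp (hins x)) hp)).symm
      refine eventually_congr ?_
      filter_upwards [aeH x] with η hη
      refine eventually_congr ?_
      filter_upwards [aeG x] with γ hγ
      simp only [htG, htH, totalAct_of_eq hγ, totalAct_of_eq hη,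
        totalAct_of_eq ((hsXinv x γ hγ).trans hη),
        totalAct_of_eq ((hX.rX_ract x η hη).trans hγ), hcomm x γ η hγ hη]
  have hnullH := ae_mem_iff_ae_act_mem sysG sysH (fun x => by
      filter_upwards [aeG x] with γ hγ
      change sigH (sX (tG x γ)) = sigH (sX x)
      rw [htG, totalAct_of_eq hγ, hsXinv x γ hγ]) (fun x => by
      filter_upwards [aeG x] with γ hγ
      filter_upwards [aeH x] with η hη
      exact totalAct_totalAct_inv hG hactG hsXinv hX.rX_ract hcomm hγ hη) hE
  have hnullG := ae_mem_iff_ae_act_mem sysH sysG (fun x => by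
      filter_upwards [aeH x] with η hη
      change lamG (rX (tH x η)) = lamG (rX x)
      rw [htH, totalAct_of_eq hη, hX.rX_ract x η hη]) (fun x => by
      filter_upwards [aeH x] with η hη
      filter_upwards [aeG x] with γ hγ
      exact totalAct_totalAct_inv hH hactH hX.rX_ract hsXinv
        (fun x η γ hη hγ => (hcomm x γ η hγ hη).symm) hη hγ) hE'
  constructor
  · rw [hkerG, isQuasiInvariant_iff _ measG hclosedG]
    · intro p hp
      have h := sysG.ae_inv_iff hnullG (p := fun z => p (z.2, z.1)) (measurable_swap hp)
      simp only [aeGbar _ hp]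
      rw [h]
      exact (eventually_congr (.of_forall fun x => aeGbar x (measG hp))).symm
    · rintro ⟨γ, x⟩ hγ
      have hγ' : rX x = G.r γ := Eq.symm hγ
      simp only [GbarData, htG, totalAct_of_eq hγ']
    · intro x
      rw [aeGbar x (p := (· ∈ GbarCond G rX)) hclosedG]
      filter_upwards [aeG x] with γ hγ using hγ.symm
  · rw [hkerH, isQuasiInvariant_iff _ measH hclosedH]
    · intro p hp
      have h := sysH.ae_inv_iff hnullH hp
      simp only [aeHbar _ hp]
      rw [h]
      exact (eventually_congr (.of_forall fun x => aeHbar x (measH hp))).symm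
    · rintro ⟨x, η⟩ hη
      have hη' : sX x = H.r η := hη
      simp only [HbarData, htH, totalAct_of_eq hη']
    · intro x
      rw [aeHbar x (p := (· ∈ HbarCond H sX)) hclosedH]
      exact aeH x
end

section
/- Let μ be a Radon measure on X quasi-invariant with respect to E = G⋉X⋊H, with ν = μ∘λ_E, and let Δ^Ḡ_μ, Δ^H̄_μ, Δ^E_μ denote the modular functions of μ with respect to Ḡ = G⋉X, H̄ = X⋊H, and E respectively. Then ν-almost everywhere, Δ^Ḡ_μ(γ,x)·Δ^H̄_μ(γ⁻¹·x, η) = Δ^E_μ(γ,x,η) = Δ^Ḡ_μ(γ, x·η)·Δ^H̄_μ(x,η). -/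
open MeasureTheory Filter Topology

section HaarKernels

open ProbabilityTheory

/-- In a second countable locally compact Hausdorff space, a family of measures finite on compacts
whose integrals of compactly supported continuous functions depend continuously on the parameter
takes measurable values on open sets. -/
lemma measurable_measure_isOpen {Y A : Type*} [TopologicalSpace Y] [MeasurableSpace Y]
    [OpensMeasurableSpace Y] [TopologicalSpace A] [T2Space A] [SecondCountableTopology A]
    [LocallyCompactSpace A] [MeasurableSpace A] [BorelSpace A]
    (κ : Y → Measure A) (hfin : ∀ y K, IsCompact K → κ y K < ⊤)
    (hcont : ∀ f : A → ℝ, Continuous f → HasCompactSupport f → Continuous fun y => ∫ a, f a ∂κ y)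
    {V : Set A} (hV : IsOpen V) : Measurable fun y => κ y V := by
  have : LocallyCompactSpace V := hV.locallyCompactSpace
  let K : ℕ → Set A := fun n => Subtype.val '' compactCovering V n
  have hK : ∀ n, IsCompact (K n) := fun n =>
    (isCompact_compactCovering V n).image continuous_subtype_val
  have hKV : ∀ n, K n ⊆ V := fun n => by rintro _ ⟨a, -, rfl⟩; exact a.2
  have hKU : ⋃ n, K n = V := by
    rw [← Set.image_iUnion, iUnion_compactCovering, Set.image_univ, Subtype.range_coe]
  have hmono : Monotone K := fun m n h => Set.image_mono (compactCovering_subset V h)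
  choose f hf1 hf0 hfc hf01 using fun n => exists_continuous_one_zero_of_isCompact (hK n)
    hV.isClosed_compl (Set.disjoint_compl_right_iff_subset.2 (hKV n))
  have key : ∀ y n, ENNReal.ofReal (∫ a, f n a ∂κ y) = ∫⁻ a, ENNReal.ofReal (f n a) ∂κ y := by
    intro y n
    have : IsFiniteMeasureOnCompacts (κ y) := ⟨fun K hK => hfin y K hK⟩
    exact ofReal_integral_eq_lintegral_ofReal
      ((f n).continuous.integrable_of_hasCompactSupport (hfc n))
      (Eventually.of_forall fun a => (hf01 n a).1)
  have hsup : (fun y => κ y V) = fun y => ⨆ n, ENNReal.ofReal (∫ a, f n a ∂κ y) := by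
    ext y
    apply le_antisymm
    · rw [← hKU, hmono.measure_iUnion]
      refine iSup_mono fun n => ?_
      rw [key, ← lintegral_indicator_one (hK n).measurableSet]
      refine lintegral_mono fun a => ?_
      by_cases ha : a ∈ K n
      · simp [ha, hf1 n ha]
      · simp [ha]
    · refine iSup_le fun n => ?_
      rw [key, ← lintegral_indicator_one hV.measurableSet]
      refine lintegral_mono fun a => ?_
      by_cases ha : a ∈ V
      · simpa [ha] using (hf01 n a).2
      · simp [ha, hf0 n ha]
  rw [hsup]
  exact Measurable.iSup fun n =>
    ENNReal.measurable_ofReal.comp (hcont _ (f n).continuous (hfc n)).measurable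

/-- A vaguely continuous family of Radon measures is measurable. -/
lemma measurable_of_continuous_integral_s8 {Y A : Type*} [TopologicalSpace Y] [MeasurableSpace Y]
    [OpensMeasurableSpace Y] [TopologicalSpace A] [T2Space A] [SecondCountableTopology A]
    [LocallyCompactSpace A] [MeasurableSpace A] [BorelSpace A]
    (κ : Y → Measure A) (hfin : ∀ y K, IsCompact K → κ y K < ⊤)
    (hcont : ∀ f : A → ℝ, Continuous f → HasCompactSupport f → Continuous fun y => ∫ a, f a ∂κ y) :
    Measurable κ := by
  let C : CompactExhaustion A := default
  let U : ℕ → Set A := fun n => interior (C n)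
  have hUm : Monotone U := fun m n h => interior_mono (C.subset h)
  have hUU : ⋃ n, U n = Set.univ := by
    refine Set.eq_univ_of_forall fun a => ?_
    obtain ⟨n, hn⟩ := Set.mem_iUnion.1 (C.iUnion_eq.symm ▸ Set.mem_univ a)
    exact Set.mem_iUnion.2 ⟨n + 1, C.subset_interior_succ n hn⟩
  have hr : ∀ n, Measurable fun y => (κ y).restrict (U n) := by
    intro n
    have : ∀ y, IsFiniteMeasure ((κ y).restrict (U n)) := fun y =>
      ⟨by
        rw [Measure.restrict_apply_univ]
        exact (measure_mono interior_subset).trans_lt (hfin y _ (C.isCompact n))⟩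
    refine Measurable.measure_of_isPiSystem (S := {s : Set A | IsOpen s})
      (BorelSpace.measurable_eq.trans rfl) isPiSystem_isOpen ?_ ?_
    · intro s hs
      have hs' : IsOpen s := hs
      simp only [Measure.restrict_apply hs'.measurableSet]
      exact measurable_measure_isOpen κ hfin hcont (hs'.inter isOpen_interior)
    · simp only [Measure.restrict_apply_univ]
      exact measurable_measure_isOpen κ hfin hcont isOpen_interior
  refine Measure.measurable_of_measurable_coe _ fun s hs => ?_
  have : (fun y => κ y s) = fun y => ⨆ n, (κ y).restrict (U n) s := by
    ext y
    simp only [Measure.restrict_apply hs]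
    rw [← Monotone.measure_iUnion (fun m n h => Set.inter_subset_inter_right s (hUm h)),
      ← Set.inter_iUnion, hUU, Set.inter_univ]
  rw [this]
  exact Measurable.iSup fun n => (Measure.measurable_coe hs).comp (hr n)

/-- A kernel all of whose measures are finite on each set of a countable measurable cover of the
target is s-finite. -/
lemma isSFiniteKernel_of_cover {Y A : Type*} [MeasurableSpace Y] [MeasurableSpace A]
    (κ : Kernel Y A) (C : ℕ → Set A) (hC : ∀ n, MeasurableSet (C n))
    (hU : ⋃ n, C n = Set.univ) (hfin : ∀ y n, κ y (C n) < ⊤) : IsSFiniteKernel κ := by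
  classical
  let D := disjointed C
  have hD : ∀ n, MeasurableSet (D n) := fun n => MeasurableSet.disjointed hC n
  have hDfin : ∀ y n, κ y (D n) < ⊤ := fun y n =>
    (measure_mono (disjointed_subset C n)).trans_lt (hfin y n)
  let N : ℕ → Y → ℕ := fun n y => ⌊(κ y (D n)).toReal⌋₊
  have hN : ∀ n m, MeasurableSet (N n ⁻¹' {m}) := fun n m =>
    (Nat.measurable_floor.comp (κ.measurable_coe (hD n)).ennreal_toReal) (measurableSet_singleton m)
  let κs : ℕ × ℕ → Kernel Y A := fun p =>
    Kernel.piecewise (hN p.1 p.2) (κ.restrict (hD p.1)) 0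
  have hfinite : ∀ p, IsFiniteKernel (κs p) := fun p =>
    ⟨⟨ENNReal.ofReal (p.2 + 1), ENNReal.ofReal_lt_top, fun y => by
      rw [Kernel.piecewise_apply']
      split_ifs with h
      · have h' : N p.1 y = p.2 := h
        rw [Kernel.restrict_apply, Measure.restrict_apply_univ,
          ← ENNReal.ofReal_toReal (hDfin y p.1).ne]
        refine ENNReal.ofReal_le_ofReal ?_
        rw [← h']
        exact (Nat.lt_floor_add_one _).le
      · simp⟩⟩
  have hsum : κ = Kernel.sum κs := by
    ext y s hs
    rw [Kernel.sum_apply' _ _ hs, ENNReal.tsum_prod (f := fun n m => κs (n, m) y s)]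
    have h1 : ∀ n, ∑' m, κs (n, m) y s = κ y (s ∩ D n) := by
      intro n
      rw [tsum_eq_single (N n y)]
      · simp [κs, Kernel.piecewise_apply', Kernel.restrict_apply, Measure.restrict_apply hs]
      · intro m hm
        simp [κs, Kernel.piecewise_apply', hm.symm]
    simp_rw [h1]
    rw [← measure_iUnion (fun i j hij => ((disjoint_disjointed C hij).mono
      Set.inter_subset_right Set.inter_subset_right)) (fun n => hs.inter (hD n)),
      ← Set.inter_iUnion, iUnion_disjointed, hU, Set.inter_univ]
  rw [hsum]
  exact Kernel.isSFiniteKernel_sum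

/-- Composing two Radon–Nikodym cocycles along two commuting fibrewise systems of measures. -/
lemma lintegral_eq_lintegral_mul_densities {A B X : Type*} [MeasurableSpace A] [MeasurableSpace B]
    [MeasurableSpace X] (k : Kernel X A) (l : Kernel X B) [IsSFiniteKernel k] [IsSFiniteKernel l]
    (μ : Measure X) {ia : A → A} {ib : B → B} {sA : A × X → X} {sB : B × X → X}
    (hia : Measurable ia) (hsA : Measurable sA)
    (hl : ∀ x, ∀ᵐ a ∂k x, l (sA (a, x)) = l x)
    (hk : ∀ x, ∀ᵐ b ∂l x, k (sB (b, x)) = k x)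
    (hinv : ∀ x, ∀ᵐ b ∂l x, ∀ᵐ a ∂k x, sA (ia a, sA (a, sB (b, x))) = sB (b, x))
    {ΔA : A × X → ENNReal} {ΔB : B × X → ENNReal} (hΔA : Measurable ΔA)
    (hA : ∀ f : A × X → ENNReal, Measurable f → ∫⁻ x, ∫⁻ a, f (a, x) ∂k x ∂μ =
      ∫⁻ x, ∫⁻ a, f (ia a, sA (a, x)) * ΔA (ia a, sA (a, x)) ∂k x ∂μ)
    (hB : ∀ f : B × X → ENNReal, Measurable f → ∫⁻ x, ∫⁻ b, f (b, x) ∂l x ∂μ =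
      ∫⁻ x, ∫⁻ b, f (ib b, sB (b, x)) * ΔB (ib b, sB (b, x)) ∂l x ∂μ)
    {f : A × X × B → ENNReal} (hf : Measurable f) :
    ∫⁻ x, ∫⁻ a, ∫⁻ b, f (a, x, b) ∂l x ∂k x ∂μ =
      ∫⁻ x, ∫⁻ b, ∫⁻ a, f (ia a, sA (a, sB (b, x)), ib b) *
        (ΔA (ia a, sA (a, sB (b, x))) * ΔB (ib b, sA (ia a, sA (a, sB (b, x))))) ∂k x ∂l x ∂μ := by
  have hF : Measurable fun p : A × X => ∫⁻ b, f (p.1, p.2, b) ∂l p.2 :=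
    Measurable.lintegral_kernel_prod_right' (κ := l.comap Prod.snd measurable_snd)
      (f := fun q : (A × X) × B => f (q.1.1, q.1.2, q.2)) (by fun_prop)
  have hK : Measurable fun p : B × X =>
      ∫⁻ a, f (ia a, sA (a, p.2), p.1) * ΔA (ia a, sA (a, p.2)) ∂k p.2 :=
    Measurable.lintegral_kernel_prod_right' (κ := k.comap Prod.snd measurable_snd)
      (f := fun q : (B × X) × A =>
        f (ia q.2, sA (q.2, q.1.2), q.1.1) * ΔA (ia q.2, sA (q.2, q.1.2))) (by fun_prop)
  calc
    _ = ∫⁻ x, ∫⁻ a, (∫⁻ b, f (ia a, sA (a, x), b) ∂l (sA (a, x))) *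
          ΔA (ia a, sA (a, x)) ∂k x ∂μ := hA _ hF
    _ = ∫⁻ x, ∫⁻ a, ∫⁻ b, f (ia a, sA (a, x), b) * ΔA (ia a, sA (a, x)) ∂l x ∂k x ∂μ := by
      refine lintegral_congr fun x => lintegral_congr_ae ?_
      filter_upwards [hl x] with a ha
      rw [ha, lintegral_mul_const _ (by fun_prop)]
    _ = ∫⁻ x, ∫⁻ b, ∫⁻ a, f (ia a, sA (a, x), b) * ΔA (ia a, sA (a, x)) ∂k x ∂l x ∂μ := by
      refine lintegral_congr fun x => lintegral_lintegral_swap ?_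
      exact Measurable.aemeasurable (by fun_prop)
    _ = ∫⁻ x, ∫⁻ b, (∫⁻ a, f (ia a, sA (a, sB (b, x)), ib b) *
          ΔA (ia a, sA (a, sB (b, x))) ∂k (sB (b, x))) * ΔB (ib b, sB (b, x)) ∂l x ∂μ := hB _ hK
    _ = _ := by
      refine lintegral_congr fun x => lintegral_congr_ae ?_
      filter_upwards [hk x, hinv x] with b hb hb'
      rw [hb, ← lintegral_mul_const _ (by fun_prop)]
      refine lintegral_congr_ae ?_
      filter_upwards [hb'] with a ha
      rw [ha, mul_assoc]

/-- Two densities of a `σ`-finite measure with respect to its image under an almost everywhere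
involutive map agree almost everywhere. -/
lemma ae_eq_of_lintegral_eq_lintegral_comp {α : Type*} [MeasurableSpace α] {ν : Measure α}
    [SigmaFinite ν] {i : α → α} (hi : Measurable i) (hii : ∀ᵐ a ∂ν, i (i a) = a)
    (hac : ν ≪ ν.map i) {D D' : α → ENNReal} (hD : Measurable D) (hD' : Measurable D')
    (h : ∀ f : α → ENNReal, Measurable f → ∫⁻ a, f a ∂ν = ∫⁻ a, f (i a) * D (i a) ∂ν)
    (h' : ∀ f : α → ENNReal, Measurable f → ∫⁻ a, f a ∂ν = ∫⁻ a, f (i a) * D' (i a) ∂ν) :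
    D =ᵐ[ν] D' := by
  have key : ∀ E : α → ENNReal,
      (∀ f : α → ENNReal, Measurable f → ∫⁻ a, f a ∂ν = ∫⁻ a, f (i a) * E (i a) ∂ν) →
      ∀ s, MeasurableSet s → ∫⁻ a in s, E (i a) ∂ν = ∫⁻ a, s.indicator 1 (i a) ∂ν := by
    intro E hE s hs
    rw [hE (fun a => s.indicator 1 (i a)) ((measurable_one.indicator hs).comp hi),
      ← lintegral_indicator hs]
    refine lintegral_congr_ae ?_
    filter_upwards [hii] with a ha
    simp only [ha]
    by_cases has : a ∈ s <;> simp [has]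
  have : (fun a => D (i a)) =ᵐ[ν] fun a => D' (i a) :=
    ae_eq_of_forall_setLIntegral_eq_of_sigmaFinite (hD.comp hi) (hD'.comp hi)
      fun s hs _ => (key D h s hs).trans (key D' h' s hs).symm
  exact hac.ae_eq ((ae_map_iff hi.aemeasurable (measurableSet_eq_fun hD hD')).2 this)

/-- The integral form of being a density with respect to an image measure. -/
lemma lintegral_eq_lintegral_comp_mul_of_withDensity {α : Type*} [MeasurableSpace α]
    {ν : Measure α} {i j : α → α} (hi : Measurable i) (hij : j =ᵐ[ν] i) {D : α → ENNReal}
    (hD : Measurable D) (h : (ν.map j).withDensity D = ν) {f : α → ENNReal} (hf : Measurable f) :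
    ∫⁻ a, f a ∂ν = ∫⁻ a, f (i a) * D (i a) ∂ν := by
  conv_lhs => rw [← h]
  rw [Measure.map_congr hij, lintegral_withDensity_eq_lintegral_mul _ hD hf,
    lintegral_map (hD.mul hf) hi]
  simp only [Pi.mul_apply, mul_comm]

/-- A property holding almost everywhere in every fibre of a disintegrated measure holds almost
everywhere. -/
lemma ae_of_lintegral_eq {A X α : Type*} [MeasurableSpace A]
    [MeasurableSpace X] [MeasurableSpace α] {k : X → Measure A} {μ : Measure X} {ν : Measure α}
    {φ : X → A → α}
    (hν : ∀ f : α → ENNReal, Measurable f → ∫⁻ p, f p ∂ν = ∫⁻ x, ∫⁻ a, f (φ x a) ∂k x ∂μ)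
    {S : Set α} (hS : MeasurableSet S) (h : ∀ x, ∀ᵐ a ∂k x, φ x a ∈ S) : ∀ᵐ p ∂ν, p ∈ S := by
  have : ν Sᶜ = 0 := by
    rw [← lintegral_indicator_one hS.compl, hν _ (measurable_one.indicator hS.compl)]
    have h0 : ∀ x, ∫⁻ a, Sᶜ.indicator (1 : α → ENNReal) (φ x a) ∂k x = 0 := by
      intro x
      refine (lintegral_congr_ae (g := fun _ => 0) ?_).trans lintegral_zero
      filter_upwards [h x] with a ha
      simp [ha]
    simp [h0]
  exact this

/-- A property holding almost everywhere in every fibre of a measure disintegrated into products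
holds almost everywhere. -/
lemma ae_of_lintegral_eq_iterated {A B X : Type*} [MeasurableSpace A] [MeasurableSpace B]
    [MeasurableSpace X] {k : X → Measure A} {l : X → Measure B} {μ : Measure X}
    {ν : Measure (A × X × B)}
    (hν : ∀ f : A × X × B → ENNReal, Measurable f →
      ∫⁻ a, f a ∂ν = ∫⁻ x, ∫⁻ a, ∫⁻ b, f (a, x, b) ∂l x ∂k x ∂μ)
    {S : Set (A × X × B)} (hS : MeasurableSet S)
    (h : ∀ x, ∀ᵐ a ∂k x, ∀ᵐ b ∂l x, (a, x, b) ∈ S) : ∀ᵐ p ∂ν, p ∈ S := by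
  have : ν Sᶜ = 0 := by
    rw [← lintegral_indicator_one hS.compl, hν _ (measurable_one.indicator hS.compl)]
    have h0 : ∀ x, ∫⁻ a, ∫⁻ b, Sᶜ.indicator (1 : A × X × B → ENNReal) (a, x, b) ∂l x ∂k x = 0 := by
      intro x
      refine (lintegral_congr_ae (g := fun _ => 0) ?_).trans lintegral_zero
      filter_upwards [h x] with a ha
      refine (lintegral_congr_ae (g := fun _ => 0) ?_).trans lintegral_zero
      filter_upwards [ha] with b hb
      simp [hb]
    simp [h0]
  exact this

/-- A measure disintegrating through two fibrewise `σ`-finite kernels over a `σ`-finite measure is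
`σ`-finite. -/
lemma sigmaFinite_of_lintegral_eq_iterated {A B X : Type*} [MeasurableSpace A] [MeasurableSpace B]
    [MeasurableSpace X] (k : Kernel X A) (l : Kernel X B) (μ : Measure X) [SigmaFinite μ]
    {ν : Measure (A × X × B)}
    (hν : ∀ f : A × X × B → ENNReal, Measurable f →
      ∫⁻ a, f a ∂ν = ∫⁻ x, ∫⁻ a, ∫⁻ b, f (a, x, b) ∂l x ∂k x ∂μ)
    (C : ℕ → Set A) (hC : ∀ n, MeasurableSet (C n)) (hCU : ⋃ n, C n = Set.univ)
    (hCfin : ∀ x n, k x (C n) < ⊤)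
    (C' : ℕ → Set B) (hC' : ∀ n, MeasurableSet (C' n)) (hCU' : ⋃ n, C' n = Set.univ)
    (hCfin' : ∀ x n, l x (C' n) < ⊤) : SigmaFinite ν := by
  let T : ℕ × ℕ × ℕ × ℕ → Set X := fun q =>
    spanningSets μ q.2.2.1 ∩ ({x | k x (C q.1) ≤ q.2.2.2} ∩ {x | l x (C' q.2.1) ≤ q.2.2.2})
  have hT : ∀ q, MeasurableSet (T q) := fun q => (measurableSet_spanningSets μ _).inter
    ((measurableSet_le (k.measurable_coe (hC _)) measurable_const).inter
      (measurableSet_le (l.measurable_coe (hC' _)) measurable_const))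
  let S : ℕ × ℕ × ℕ × ℕ → Set (A × X × B) := fun q => C q.1 ×ˢ (T q ×ˢ C' q.2.1)
  have hS : ∀ q, MeasurableSet (S q) := fun q => (hC _).prod ((hT q).prod (hC' _))
  refine Measure.sigmaFinite_of_countable (S := Set.range S) (Set.countable_range S) ?_ ?_
  · rintro _ ⟨q, rfl⟩
    rw [← lintegral_indicator_one (hS q), hν _ (measurable_one.indicator (hS q))]
    have h1 : ∀ x, ∫⁻ a, ∫⁻ b, (S q).indicator (1 : A × X × B → ENNReal) (a, x, b) ∂l x ∂k x =
        (T q).indicator (fun x => k x (C q.1) * l x (C' q.2.1)) x := by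
      intro x
      by_cases hx : x ∈ T q
      · rw [Set.indicator_of_mem hx, ← lintegral_indicator_one (hC q.1),
          ← lintegral_mul_const _ (measurable_one.indicator (hC q.1))]
        refine lintegral_congr fun a => ?_
        rw [← lintegral_indicator_one (hC' q.2.1),
          ← lintegral_const_mul _ (measurable_one.indicator (hC' q.2.1))]
        refine lintegral_congr fun b => ?_
        by_cases ha : a ∈ C q.1 <;> by_cases hb : b ∈ C' q.2.1 <;> simp [S, ha, hb, hx]
      · simp [S, hx]
    simp_rw [h1]
    rw [lintegral_indicator (hT q)]
    calc
      _ ≤ ∫⁻ _ in T q, (q.2.2.2 : ENNReal) * q.2.2.2 ∂μ :=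
        setLIntegral_mono measurable_const fun x hx => mul_le_mul' hx.2.1 hx.2.2
      _ = (q.2.2.2 : ENNReal) * q.2.2.2 * μ (T q) := setLIntegral_const _ _
      _ < ⊤ := ENNReal.mul_lt_top (ENNReal.mul_lt_top (ENNReal.natCast_lt_top _)
          (ENNReal.natCast_lt_top _))
          ((measure_mono Set.inter_subset_left).trans_lt (measure_spanningSets_lt_top μ _))
  · refine Set.eq_univ_of_forall fun p => ?_
    obtain ⟨n, hn⟩ := Set.mem_iUnion.1 (hCU.symm ▸ Set.mem_univ p.1)
    obtain ⟨m, hm⟩ := Set.mem_iUnion.1 (hCU'.symm ▸ Set.mem_univ p.2.2)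
    obtain ⟨i, hi⟩ := Set.mem_iUnion.1 ((iUnion_spanningSets μ).symm ▸ Set.mem_univ p.2.1)
    obtain ⟨j, hj⟩ := ENNReal.exists_nat_gt
      (max_lt (hCfin p.2.1 n) (hCfin' p.2.1 m)).ne
    exact ⟨_, ⟨(n, m, i, j), rfl⟩, hn, ⟨hi, (le_max_left _ _).trans hj.le,
      (le_max_right _ _).trans hj.le⟩, hm⟩

end HaarKernels

section Groupoids

open ProbabilityTheory

lemma GroupoidData.IsGroupoid.inv_inv {Arr Obj : Type} {D : GroupoidData Arr Obj}
    (h : D.IsGroupoid) (a : Arr) : D.inv (D.inv a) = a := by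
  have h1 : D.s (D.inv (D.inv a)) = D.r (D.inv a) := h.s_inv _
  have h2 : D.s (D.inv a) = D.r a := h.s_inv a
  calc D.inv (D.inv a) = D.comp (D.inv (D.inv a)) (D.unit (D.s (D.inv (D.inv a)))) :=
        (h.comp_unit _).symm
    _ = D.comp (D.inv (D.inv a)) (D.comp (D.inv a) a) := by rw [h.inv_comp, h1, h.r_inv]
    _ = D.comp (D.comp (D.inv (D.inv a)) (D.inv a)) a := (h.comp_assoc _ _ _ h1 h2).symm
    _ = D.comp (D.unit (D.r a)) a := by rw [h.inv_comp, h2]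
    _ = a := h.unit_comp a

lemma IsLeftActionOf.act_inv_act {ArrG ObjG X : Type} {G : GroupoidData ArrG ObjG}
    {rX : X → ObjG} {lact : ArrG → X → X} (h : IsLeftActionOf G rX lact) (hG : G.IsGroupoid)
    {γ : ArrG} {x : X} (hx : G.r γ = rX x) : lact γ (lact (G.inv γ) x) = x := by
  rw [← h.comp_act _ _ _ (hG.r_inv γ).symm ((hG.s_inv γ).trans hx), hG.comp_inv, hx, h.unit_act]

lemma IsRightActionOf.act_act_inv {ArrH ObjH X : Type} {H : GroupoidData ArrH ObjH}
    {sX : X → ObjH} {ract : X → ArrH → X} (h : IsRightActionOf H sX ract) (hH : H.IsGroupoid)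
    {η : ArrH} {x : X} (hx : sX x = H.r η) : ract (ract x η) (H.inv η) = x := by
  rw [← h.comp_act _ _ _ hx (hH.r_inv η).symm, hH.comp_inv, ← hx, h.unit_act]

section Haar

variable {Arr Obj X : Type} [TopologicalSpace Arr] [TopologicalSpace Obj] [TopologicalSpace X]
  [MeasurableSpace Arr] {D : GroupoidData Arr Obj} {κ : Obj → Measure Arr}

lemma IsHaarSystemOn.ae_r_eq_s8 (h : IsHaarSystemOn D Set.univ κ) (u : Obj) :
    ∀ᵐ a ∂κ u, D.r a = u := by
  have := h.1 u
  rwa [Set.inter_univ] at this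

/-- The pullback of a Haar system along a continuous map, as a kernel. -/
noncomputable def IsHaarSystemOn.kernel_s8 [T2Space Arr] [SecondCountableTopology Arr]
    [LocallyCompactSpace Arr] [BorelSpace Arr] [MeasurableSpace X] [OpensMeasurableSpace X]
    (h : IsHaarSystemOn D Set.univ κ) {m : X → Obj} (hm : Continuous m) : Kernel X Arr where
  toFun x := κ (m x)
  measurable' := measurable_of_continuous_integral_s8 _ (fun x K hK => h.2.2.1 (m x) K hK)
    fun f hf hfc => (h.2.2.2.2 f hf hfc).comp hm

variable [T2Space Arr] [SecondCountableTopology Arr]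
    [LocallyCompactSpace Arr] [BorelSpace Arr] [MeasurableSpace X] [OpensMeasurableSpace X]

instance IsHaarSystemOn.isSFiniteKernel_kernel (h : IsHaarSystemOn D Set.univ κ) {m : X → Obj}
    (hm : Continuous m) : IsSFiniteKernel (h.kernel_s8 hm) :=
  isSFiniteKernel_of_cover _ (compactCovering Arr)
    (fun n => (isCompact_compactCovering Arr n).measurableSet) (iUnion_compactCovering Arr)
    fun x n => h.2.2.1 (m x) _ (isCompact_compactCovering Arr n)

end Haar

section Iterated

variable {ArrG ObjG ArrH ObjH X : Type} [MeasurableSpace ArrG] [MeasurableSpace ArrH]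
  [MeasurableSpace X] {rX : X → ObjG} {sX : X → ObjH} {lamG : ObjG → Measure ArrG}
  {sigH : ObjH → Measure ArrH} {μ : Measure X}

lemma lintegral_nuMeasure_EHaar (k : Kernel X ArrG) (l : Kernel X ArrH) [IsSFiniteKernel k]
    [IsSFiniteKernel l] (hk : ∀ x, k x = lamG (rX x)) (hl : ∀ x, l x = sigH (sX x))
    {f : ArrG × X × ArrH → ENNReal} (hf : Measurable f) :
    ∫⁻ a, f a ∂(nuMeasure (EHaar lamG sigH rX sX) μ) =
      ∫⁻ x, ∫⁻ a, ∫⁻ b, f (a, x, b) ∂l x ∂k x ∂μ := by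
  have h : EHaar lamG sigH rX sX = ⇑(k ×ₖ (Kernel.id ×ₖ l)) := by
    ext1 x
    rw [Kernel.prod_apply, Kernel.prod_apply, Kernel.id_apply, hk, hl]
    rfl
  rw [nuMeasure, h, Measure.lintegral_bind (Kernel.aemeasurable _) hf.aemeasurable]
  refine lintegral_congr fun x => ?_
  rw [Kernel.lintegral_prod _ _ _ hf]
  refine lintegral_congr fun a => ?_
  rw [Kernel.lintegral_prod _ _ _ (by fun_prop), Kernel.id_apply, lintegral_dirac']
  exact Measurable.lintegral_prod_right' (f := fun p : X × ArrH => f (a, p.1, p.2)) (by fun_prop)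

lemma lintegral_nuMeasure_GbarHaar (k : Kernel X ArrG) [IsSFiniteKernel k]
    (hk : ∀ x, k x = lamG (rX x)) {f : ArrG × X → ENNReal} (hf : Measurable f) :
    ∫⁻ a, f a ∂(nuMeasure (GbarHaar lamG rX) μ) = ∫⁻ x, ∫⁻ a, f (a, x) ∂k x ∂μ := by
  have h : GbarHaar lamG rX = ⇑(k ×ₖ Kernel.id) := by
    ext1 x
    rw [Kernel.prod_apply, Kernel.id_apply, hk]
    rfl
  rw [nuMeasure, h, Measure.lintegral_bind (Kernel.aemeasurable _) hf.aemeasurable]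
  refine lintegral_congr fun x => ?_
  rw [Kernel.lintegral_prod _ _ _ hf]
  refine lintegral_congr fun a => ?_
  rw [Kernel.id_apply, lintegral_dirac' _ (by fun_prop)]

lemma lintegral_nuMeasure_HbarHaar (l : Kernel X ArrH) [IsSFiniteKernel l]
    (hl : ∀ x, l x = sigH (sX x)) {f : X × ArrH → ENNReal} (hf : Measurable f) :
    ∫⁻ a, f a ∂(nuMeasure (HbarHaar sigH sX) μ) = ∫⁻ x, ∫⁻ b, f (x, b) ∂l x ∂μ := by
  have h : HbarHaar sigH sX = ⇑(Kernel.id ×ₖ l) := by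
    ext1 x
    rw [Kernel.prod_apply, Kernel.id_apply, hl]
    rfl
  rw [nuMeasure, h, Measure.lintegral_bind (Kernel.aemeasurable _) hf.aemeasurable]
  refine lintegral_congr fun x => ?_
  rw [Kernel.lintegral_prod _ _ _ hf, Kernel.id_apply, lintegral_dirac']
  exact Measurable.lintegral_prod_right' hf

end Iterated

section SourceMaps

variable {ArrG ObjG ArrH ObjH X : Type}

open Classical in
/-- The source map `(γ, x) ↦ γ⁻¹ · x` of `G ⋉ X`, extended by `(γ, x) ↦ x` to all pairs. -/
noncomputable def gbarSource (G : GroupoidData ArrG ObjG) (rX : X → ObjG) (lact : ArrG → X → X) :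
    ArrG × X → X :=
  (GbarCond G rX).piecewise (GbarData G rX lact).s Prod.snd

open Classical in
/-- The source map `(η, x) ↦ x · η` of `X ⋊ H`, extended by `(η, x) ↦ x` to all pairs. -/
noncomputable def hbarSource (H : GroupoidData ArrH ObjH) (sX : X → ObjH) (ract : X → ArrH → X) :
    ArrH × X → X :=
  (Prod.swap ⁻¹' HbarCond H sX).piecewise (fun p => ract p.2 p.1) Prod.snd

open Classical in
lemma gbarSource_of_eq {G : GroupoidData ArrG ObjG} {rX : X → ObjG} {lact : ArrG → X → X}
    {γ : ArrG} {x : X} (h : G.r γ = rX x) : gbarSource G rX lact (γ, x) = lact (G.inv γ) x :=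
  Set.piecewise_eq_of_mem _ _ _ h

open Classical in
lemma hbarSource_of_eq {H : GroupoidData ArrH ObjH} {sX : X → ObjH} {ract : X → ArrH → X}
    {η : ArrH} {x : X} (h : sX x = H.r η) : hbarSource H sX ract (η, x) = ract x η :=
  Set.piecewise_eq_of_mem _ _ _ h

variable [TopologicalSpace ArrG] [TopologicalSpace ObjG] [TopologicalSpace ArrH]
    [TopologicalSpace ObjH] [TopologicalSpace X]
    {G : GroupoidData ArrG ObjG} {H : GroupoidData ArrH ObjH} {rX : X → ObjG} {sX : X → ObjH}
    {lact : ArrG → X → X} {ract : X → ArrH → X}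

lemma IsTopEquivalence.isClosed_gbarCond [T2Space ObjG]
    (h : IsTopEquivalence G H rX sX lact ract) : IsClosed (GbarCond G rX) :=
  isClosed_eq (h.G_top.continuous_r.comp continuous_fst) (h.continuous_rX.comp continuous_snd)

lemma IsTopEquivalence.isClosed_hbarCond [T2Space ObjH]
    (h : IsTopEquivalence G H rX sX lact ract) : IsClosed (HbarCond H sX) :=
  isClosed_eq (h.continuous_sX.comp continuous_fst) (h.H_top.continuous_r.comp continuous_snd)

variable [MeasurableSpace X] [BorelSpace X] [SecondCountableTopology X]

open Classical in
lemma IsTopEquivalence.measurable_gbarSource [T2Space ObjG] [SecondCountableTopology ArrG]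
    [MeasurableSpace ArrG] [BorelSpace ArrG]
    (h : IsTopEquivalence G H rX sX lact ract) : Measurable (gbarSource G rX lact) := by
  refine ContinuousOn.measurable_piecewise ?_ continuous_snd.continuousOn
    h.isClosed_gbarCond.measurableSet
  rw [continuousOn_iff_continuous_domRestrict]
  have hc : Continuous fun p : GbarCond G rX =>
      (⟨(G.inv p.1.1, p.1.2), (h.G_groupoid.s_inv _).trans p.2⟩ :
        {q : ArrG × X // G.s q.1 = rX q.2}) :=
    ((h.G_top.continuous_inv.comp (continuous_fst.comp continuous_subtype_val)).prodMk
      (continuous_snd.comp continuous_subtype_val)).subtype_mk _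
  exact h.continuous_lact.comp hc

open Classical in
lemma IsTopEquivalence.measurable_hbarSource [T2Space ObjH] [SecondCountableTopology ArrH]
    [MeasurableSpace ArrH] [BorelSpace ArrH]
    (h : IsTopEquivalence G H rX sX lact ract) : Measurable (hbarSource H sX ract) := by
  refine ContinuousOn.measurable_piecewise ?_ continuous_snd.continuousOn
    (h.isClosed_hbarCond.preimage continuous_swap).measurableSet
  rw [continuousOn_iff_continuous_domRestrict]
  have hc : Continuous fun p : (Prod.swap ⁻¹' HbarCond H sX : Set (ArrH × X)) =>
      (⟨(p.1.2, p.1.1), p.2⟩ : {q : X × ArrH // sX q.1 = H.r q.2}) :=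
    ((continuous_snd.comp continuous_subtype_val).prodMk
      (continuous_fst.comp continuous_subtype_val)).subtype_mk _
  exact h.continuous_ract.comp hc

end SourceMaps

end Groupoids

open scoped ENNReal

/-- Let `μ` be quasi-invariant for `E = G ⋉ X ⋊ H` and let
`Δ^Ḡ_μ`, `Δ^H̄_μ`, `Δ^E_μ` be (versions of) the modular functions of `μ` with
respect to `Ḡ = G⋉X`, `H̄ = X⋊H` and `E`.  Then `ν`-almost everywhere
`Δ^Ḡ_μ(γ,x)·Δ^H̄_μ(γ⁻¹·x,η) = Δ^E_μ(γ,x,η) = Δ^Ḡ_μ(γ,x·η)·Δ^H̄_μ(x,η)`. -/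
theorem statement8
    {ArrG ObjG ArrH ObjH X : Type}
    [TopologicalSpace ArrG] [TopologicalSpace ObjG] [TopologicalSpace ArrH]
    [TopologicalSpace ObjH] [TopologicalSpace X]
    [T2Space ArrG] [T2Space ObjG] [T2Space ArrH] [T2Space ObjH] [T2Space X]
    [SecondCountableTopology ArrG] [SecondCountableTopology ObjG]
    [SecondCountableTopology ArrH] [SecondCountableTopology ObjH]
    [SecondCountableTopology X]
    [LocallyCompactSpace ArrG] [LocallyCompactSpace ObjG] [LocallyCompactSpace ArrH]
    [LocallyCompactSpace ObjH] [LocallyCompactSpace X]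
    [MeasurableSpace ArrG] [BorelSpace ArrG] [MeasurableSpace ArrH] [BorelSpace ArrH]
    [MeasurableSpace X] [BorelSpace X] [MeasurableSpace ObjH] [BorelSpace ObjH]
    (G : GroupoidData ArrG ObjG) (H : GroupoidData ArrH ObjH)
    (rX : X → ObjG) (sX : X → ObjH) (lact : ArrG → X → X) (ract : X → ArrH → X)
    (heq : IsTopEquivalence G H rX sX lact ract)
    (lamG : ObjG → MeasureTheory.Measure ArrG)
    (hlamG : IsHaarSystemOn G Set.univ lamG)
    (sigH : ObjH → MeasureTheory.Measure ArrH)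
    (hsigH : IsHaarSystemOn H Set.univ sigH)
    (μ : MeasureTheory.Measure X) [μ.Regular]
    (hqiE : IsQuasiInvariant (EHaar lamG sigH rX sX)
      (EData G H rX sX lact ract).inv μ)
    (hqiG : IsQuasiInvariant (GbarHaar lamG rX) (GbarData G rX lact).inv μ)
    (hqiH : IsQuasiInvariant (HbarHaar sigH sX) (HbarData H sX ract).inv μ)
    (ΔE : ArrG × X × ArrH → ℝ≥0∞) (hΔEm : Measurable ΔE)
    (hΔE : ((nuMeasure (EHaar lamG sigH rX sX) μ).map
        (EData G H rX sX lact ract).inv).withDensity ΔE =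
      nuMeasure (EHaar lamG sigH rX sX) μ)
    (ΔG : ArrG × X → ℝ≥0∞) (hΔGm : Measurable ΔG)
    (hΔG : ((nuMeasure (GbarHaar lamG rX) μ).map
        (GbarData G rX lact).inv).withDensity ΔG =
      nuMeasure (GbarHaar lamG rX) μ)
    (ΔH : X × ArrH → ℝ≥0∞) (hΔHm : Measurable ΔH)
    (hΔH : ((nuMeasure (HbarHaar sigH sX) μ).map
        (HbarData H sX ract).inv).withDensity ΔH =
      nuMeasure (HbarHaar sigH sX) μ)
    : ∀ᵐ a ∂(nuMeasure (EHaar lamG sigH rX sX) μ),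
        ΔG (a.1, a.2.1) * ΔH (lact (G.inv a.1) a.2.1, a.2.2) = ΔE a ∧
        ΔE a = ΔG (a.1, ract a.2.1 a.2.2) * ΔH (a.2.1, a.2.2) := by
  have hE := heq.equivalence
  have hGg := heq.G_groupoid
  have hHg := heq.H_groupoid
  have hL := hE.left_action
  have hR := hE.right_action
  let k := hlamG.kernel_s8 heq.continuous_rX
  let l := hsigH.kernel_s8 heq.continuous_sX
  have hk : ∀ x, k x = lamG (rX x) := fun _ => rfl
  have hl : ∀ x, l x = sigH (sX x) := fun _ => rfl
  have hkr : ∀ x, ∀ᵐ γ ∂k x, G.r γ = rX x := fun x => hlamG.ae_r_eq_s8 _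
  have hlr : ∀ x, ∀ᵐ η ∂l x, sX x = H.r η := fun x => (hsigH.ae_r_eq_s8 _).mono fun _ h => h.symm
  let sA := gbarSource G rX lact
  let sB := hbarSource H sX ract
  have hsA : Measurable sA := heq.measurable_gbarSource
  have hsB : Measurable sB := heq.measurable_hbarSource
  have hia : Measurable G.inv := heq.G_top.continuous_inv.measurable
  have hib : Measurable H.inv := heq.H_top.continuous_inv.measurable
  have sA_eq : ∀ {γ x}, G.r γ = rX x → sA (γ, x) = lact (G.inv γ) x := fun h => gbarSource_of_eq h
  have sB_eq : ∀ {η x}, sX x = H.r η → sB (η, x) = ract x η := fun h => hbarSource_of_eq h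
  have rX_sA : ∀ {γ x}, G.r γ = rX x → rX (sA (γ, x)) = G.s γ := fun {γ x} h => by
    rw [sA_eq h, hL.moment _ _ ((hGg.s_inv γ).trans h), hGg.r_inv]
  have sX_sA : ∀ {γ x}, G.r γ = rX x → sX (sA (γ, x)) = sX x := fun {γ x} h => by
    rw [sA_eq h, hE.sX_lact _ _ ((hGg.s_inv γ).trans h)]
  have sX_sB : ∀ {η x}, sX x = H.r η → sX (sB (η, x)) = H.s η := fun {η x} h => by
    rw [sB_eq h, hR.moment _ _ h]
  have rX_sB : ∀ {η x}, sX x = H.r η → rX (sB (η, x)) = rX x := fun {η x} h => by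
    rw [sB_eq h, hE.rX_ract _ _ h]
  have comm : ∀ {γ x η}, G.r γ = rX x → sX x = H.r η →
      sB (η, sA (γ, x)) = sA (γ, sB (η, x)) := fun {γ x η} h h' => by
    rw [sB_eq ((sX_sA h).trans h'), sA_eq (h.trans (rX_sB h').symm), sA_eq h, sB_eq h',
      hE.commute _ _ _ ((hGg.s_inv γ).trans h) h']
  have sA_sA : ∀ {γ x}, G.r γ = rX x → sA (G.inv γ, sA (γ, x)) = x := fun {γ x} h => by
    rw [sA_eq ((hGg.r_inv γ).trans (rX_sA h).symm), sA_eq h, hGg.inv_inv, hL.act_inv_act hGg h]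
  have sB_sB : ∀ {η x}, sX x = H.r η → sB (H.inv η, sB (η, x)) = x := fun {η x} h => by
    rw [sB_eq ((sX_sB h).trans (hHg.r_inv η).symm), sB_eq h, hR.act_act_inv hHg h]
  set ν := nuMeasure (EHaar lamG sigH rX sX) μ
  have hν : ∀ f : ArrG × X × ArrH → ℝ≥0∞, Measurable f →
      ∫⁻ a, f a ∂ν = ∫⁻ x, ∫⁻ a, ∫⁻ b, f (a, x, b) ∂l x ∂k x ∂μ :=
    fun f hf => lintegral_nuMeasure_EHaar k l hk hl hf
  have hνG : ∀ f : ArrG × X → ℝ≥0∞, Measurable f →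
      ∫⁻ a, f a ∂(nuMeasure (GbarHaar lamG rX) μ) = ∫⁻ x, ∫⁻ a, f (a, x) ∂k x ∂μ :=
    fun f hf => lintegral_nuMeasure_GbarHaar k hk hf
  have hνH : ∀ f : X × ArrH → ℝ≥0∞, Measurable f →
      ∫⁻ a, f a ∂(nuMeasure (HbarHaar sigH sX) μ) = ∫⁻ x, ∫⁻ b, f (x, b) ∂l x ∂μ :=
    fun f hf => lintegral_nuMeasure_HbarHaar l hl hf
  have hσ : SigmaFinite ν := sigmaFinite_of_lintegral_eq_iterated k l μ hν
    (compactCovering ArrG) (fun n => (isCompact_compactCovering ArrG n).measurableSet)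
    (iUnion_compactCovering ArrG) (fun x n => hlamG.2.2.1 _ _ (isCompact_compactCovering ArrG n))
    (compactCovering ArrH) (fun n => (isCompact_compactCovering ArrH n).measurableSet)
    (iUnion_compactCovering ArrH) (fun x n => hsigH.2.2.1 _ _ (isCompact_compactCovering ArrH n))
  have hECond : ∀ᵐ a ∂ν, a ∈ ECond G H rX sX := by
    refine ae_of_lintegral_eq_iterated hν ?_ fun x => ?_
    · exact (heq.isClosed_gbarCond.measurableSet.preimage
        (measurable_fst.prodMk (measurable_fst.comp measurable_snd))).inter
        (heq.isClosed_hbarCond.measurableSet.preimage measurable_snd)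
    · filter_upwards [hkr x] with γ hγ
      filter_upwards [hlr x] with η hη
      exact ⟨hγ, hη⟩
  have hA : ∀ f : ArrG × X → ℝ≥0∞, Measurable f → ∫⁻ x, ∫⁻ a, f (a, x) ∂k x ∂μ =
      ∫⁻ x, ∫⁻ a, f (G.inv a, sA (a, x)) * ΔG (G.inv a, sA (a, x)) ∂k x ∂μ := by
    intro f hf
    have hi : Measurable fun p : ArrG × X => (G.inv p.1, sA p) := by fun_prop
    have hij : (GbarData G rX lact).inv =ᵐ[nuMeasure (GbarHaar lamG rX) μ]
        fun p : ArrG × X => (G.inv p.1, sA p) := by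
      filter_upwards [ae_of_lintegral_eq hνG heq.isClosed_gbarCond.measurableSet hkr] with p hp
      exact congrArg (Prod.mk _) (sA_eq hp).symm
    rw [← hνG f hf, lintegral_eq_lintegral_comp_mul_of_withDensity hi hij hΔGm hΔG hf,
      hνG _ (by fun_prop)]
  have hB : ∀ f : ArrH × X → ℝ≥0∞, Measurable f → ∫⁻ x, ∫⁻ b, f (b, x) ∂l x ∂μ =
      ∫⁻ x, ∫⁻ b, f (H.inv b, sB (b, x)) * ΔH (sB (b, x), H.inv b) ∂l x ∂μ := by
    intro f hf
    have hi : Measurable fun p : X × ArrH => (sB (p.2, p.1), H.inv p.2) := by fun_prop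
    have hij : (HbarData H sX ract).inv =ᵐ[nuMeasure (HbarHaar sigH sX) μ]
        fun p : X × ArrH => (sB (p.2, p.1), H.inv p.2) := by
      filter_upwards [ae_of_lintegral_eq hνH heq.isClosed_hbarCond.measurableSet hlr] with p hp
      exact congrArg (fun y => (y, H.inv p.2)) (sB_eq hp).symm
    have hf' : Measurable fun p : X × ArrH => f (p.2, p.1) := by fun_prop
    rw [← hνH _ hf', lintegral_eq_lintegral_comp_mul_of_withDensity hi hij hΔHm hΔH hf',
      hνH _ (by fun_prop)]
  let i : ArrG × X × ArrH → ArrG × X × ArrH := fun a =>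
    (G.inv a.1, sA (a.1, sB (a.2.2, a.2.1)), H.inv a.2.2)
  have hi : Measurable i := by fun_prop
  have hii : ∀ᵐ a ∂ν, i (i a) = a := by
    filter_upwards [hECond] with a ⟨h, h'⟩
    have h1 : G.r a.1 = rX (sB (a.2.2, a.2.1)) := h.trans (rX_sB h').symm
    have h2 : sX (sA (a.1, sB (a.2.2, a.2.1))) = H.r (H.inv a.2.2) := by
      rw [sX_sA h1, sX_sB h', hHg.r_inv]
    have h3 : G.r (G.inv a.1) = rX (sA (a.1, sB (a.2.2, a.2.1))) := by
      rw [rX_sA h1, hGg.r_inv]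
    refine Prod.ext (hGg.inv_inv _) (Prod.ext ?_ (hHg.inv_inv _))
    change sA (G.inv a.1, sB (H.inv a.2.2, sA (a.1, sB (a.2.2, a.2.1)))) = a.2.1
    rw [← comm h3 h2, sA_sA h1, sB_sB h']
  have hji : (EData G H rX sX lact ract).inv =ᵐ[ν] i := by
    filter_upwards [hECond] with a ⟨h, h'⟩
    refine Prod.ext rfl (Prod.ext ?_ rfl)
    change ract (lact (G.inv a.1) a.2.1) a.2.2 = sA (a.1, sB (a.2.2, a.2.1))
    rw [← comm h h', sB_eq ((sX_sA h).trans h'), sA_eq h]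
  have hac : ν ≪ ν.map i := by
    rw [← Measure.map_congr hji]
    exact hqiE.1
  have hDE : ∀ f : ArrG × X × ArrH → ℝ≥0∞, Measurable f →
      ∫⁻ a, f a ∂ν = ∫⁻ a, f (i a) * ΔE (i a) ∂ν :=
    fun f hf => lintegral_eq_lintegral_comp_mul_of_withDensity hi hji hΔEm hΔE hf
  have hlk : ∀ x, ∀ᵐ a ∂k x, l (sA (a, x)) = l x := fun x => (hkr x).mono fun γ h => by
    rw [hl, hl, sX_sA h]
  have hkl : ∀ x, ∀ᵐ b ∂l x, k (sB (b, x)) = k x := fun x => (hlr x).mono fun η h => by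
    rw [hk, hk, rX_sB h]
  have hD1m : Measurable fun a : ArrG × X × ArrH =>
      ΔG (a.1, a.2.1) * ΔH (sA (a.1, a.2.1), a.2.2) := by fun_prop
  have hD2m : Measurable fun a : ArrG × X × ArrH =>
      ΔG (a.1, sB (a.2.2, a.2.1)) * ΔH (a.2.1, a.2.2) := by fun_prop
  have hD1 : ∀ f : ArrG × X × ArrH → ℝ≥0∞, Measurable f → ∫⁻ a, f a ∂ν =
      ∫⁻ a, f (i a) * (ΔG ((i a).1, (i a).2.1) * ΔH (sA ((i a).1, (i a).2.1), (i a).2.2)) ∂ν := by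
    intro f hf
    rw [hν f hf, hν _ (by fun_prop), lintegral_eq_lintegral_mul_densities k l μ
      (ΔB := fun p => ΔH (p.2, p.1)) hia hsA hlk hkl ?_ hΔGm hA hB hf]
    · exact lintegral_congr fun x => lintegral_lintegral_swap
        (Measurable.aemeasurable (by fun_prop))
    · intro x
      filter_upwards [hlr x] with η hη
      filter_upwards [hkr x] with γ hγ
      exact sA_sA (hγ.trans (rX_sB hη).symm)
  have hD2 : ∀ f : ArrG × X × ArrH → ℝ≥0∞, Measurable f → ∫⁻ a, f a ∂ν =
      ∫⁻ a, f (i a) * (ΔG ((i a).1, sB ((i a).2.2, (i a).2.1)) * ΔH ((i a).2.1, (i a).2.2)) ∂ν := by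
    intro f hf
    have hf' : Measurable fun p : ArrH × X × ArrG => f (p.2.2, p.2.1, p.1) := by fun_prop
    have hΔH' : Measurable fun p : ArrH × X => ΔH (p.2, p.1) := by fun_prop
    have hinv : ∀ x, ∀ᵐ a ∂k x, ∀ᵐ b ∂l x,
        sB (H.inv b, sB (b, sA (a, x))) = sA (a, x) := by
      intro x
      filter_upwards [hkr x] with γ hγ
      filter_upwards [hlr x] with η hη
      exact sB_sB ((sX_sA hγ).trans hη)
    have hswap : ∫⁻ x, ∫⁻ a, ∫⁻ b, f (a, x, b) ∂l x ∂k x ∂μ =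
        ∫⁻ x, ∫⁻ b, ∫⁻ a, f (a, x, b) ∂k x ∂l x ∂μ :=
      lintegral_congr fun x => lintegral_lintegral_swap (Measurable.aemeasurable (by fun_prop))
    rw [hν f hf, hν _ (by fun_prop), hswap]
    refine (lintegral_eq_lintegral_mul_densities l k μ hib hsB hkl hlk hinv hΔH' hB hA hf').trans ?_
    refine lintegral_congr fun x => lintegral_congr_ae ?_
    filter_upwards [hkr x] with γ hγ
    refine lintegral_congr_ae ?_
    filter_upwards [hlr x] with η hη
    simp only [i, comm hγ hη, mul_comm (ΔH _)]
  filter_upwards [hECond, ae_eq_of_lintegral_eq_lintegral_comp hi hii hac hD1m hΔEm hD1 hDE,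
    ae_eq_of_lintegral_eq_lintegral_comp hi hii hac hΔEm hD2m hDE hD2] with a ⟨h, h'⟩ h1 h2
  rw [← sA_eq h, ← sB_eq h']
  exact ⟨h1, h2⟩
end
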